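/- arXiv:math/0006221 — 5 statements merged into one kernel-verified Lean document; each statement's English description precedes it below -/
import Mathlib

section
/- Let N ≥ 2 be even and let k ≥ 1, 0 ≤ l ≤ k, 0 ≤ r ≤ k be integers with l + r ≥ k. Then, in the field ℚ(q,z), the lattice-point generating polynomial satisfies p_N(k,l,r;q,z) = d^e_N(k,l,r;q,z). -/
/-!
STATEMENT 10: For even N ≥ 2 and 1 ≤ k, 0 ≤ l ≤ k, 0 ≤ r ≤ k with l + r ≥ k,
p_N(k,l,r;q,z) = d^e_N(k,l,r;q,z) in ℚ(q,z).
-/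

open MvPolynomial

noncomputable section

/-- The field `ℚ(q,z)` of rational functions in two variables. -/
abbrev K := FractionRing (MvPolynomial (Fin 2) ℚ)

/-- The variable `q` as an element of `ℚ(q,z)`. -/
def qK : K := algebraMap (MvPolynomial (Fin 2) ℚ) K (X 0)

/-- The variable `z` as an element of `ℚ(q,z)`. -/
def zK : K := algebraMap (MvPolynomial (Fin 2) ℚ) K (X 1)

def phiQ (N : ℕ) (a : Fin N → ℤ) : ℤ := ∑ t : Fin N, (t.1 + 1 : ℤ) * a t
def phiZ (N : ℕ) (a : Fin N → ℤ) : ℤ := ∑ t : Fin N, a t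

/-- The vertex `M_{m,n}` (coordinates 1-indexed in the paper; `j : Fin N`
is the coordinate `j.1 + 1`). -/
def Mvec (N : ℕ) (k l r : ℤ) (m n : ℕ) (j : Fin N) : ℤ :=
  if j.1 + 1 ≤ m then (if (j.1 + 1) % 2 = 1 then l else k - l)
  else if N - n < j.1 + 1 then (if (N - j.1) % 2 = 1 then r else k - r)
  else 0

/-- The contribution `d^{m,n}_N(k,l,r;q,z)` of the vertex `M_{m,n}`, in `ℚ(q,z)`. -/
def dmn (N : ℕ) (k l r : ℤ) (m n : ℕ) : K :=
  qK ^ phiQ N (Mvec N k l r m n) * zK ^ phiZ N (Mvec N k l r m n) /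
    ((∏ i ∈ Finset.Icc 1 (m / 2), (1 - qK ^ (i : ℤ))) *
     (∏ i ∈ Finset.Icc (m / 2 + 1) m, (1 - qK ^ (-(i : ℤ)) * zK⁻¹)) *
     (∏ i ∈ Finset.Icc (m + 1) (N - n), (1 - qK ^ (i : ℤ) * zK)) *
     (∏ i ∈ Finset.Icc 1 (n / 2), (1 - qK ^ (-(i : ℤ)))) *
     (∏ i ∈ Finset.Icc (n / 2 + 1) n, (1 - qK ^ ((i : ℤ) - N - 1) * zK⁻¹)))

/-- `d^e_N(k,l,r;q,z)`: sum of `d^{m,n}_N` over `m, n ≥ 0` with `m+n < N`, or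
`m+n = N` and `m` even. -/
def dE (N : ℕ) (k l r : ℤ) : K :=
  ∑ p ∈ (Finset.range (N + 1) ×ˢ Finset.range (N + 1)).filter
      (fun p => p.1 + p.2 < N ∨ (p.1 + p.2 = N ∧ Even p.1)),
    dmn N k l r p.1 p.2

/-- `d^o_N(k,l,r;q,z)`: sum of `d^{m,n}_N` over `m, n ≥ 0` with `m+n < N`, or
`m+n = N` and `m` odd. -/
def dO (N : ℕ) (k l r : ℤ) : K :=
  ∑ p ∈ (Finset.range (N + 1) ×ˢ Finset.range (N + 1)).filter
      (fun p => p.1 + p.2 < N ∨ (p.1 + p.2 = N ∧ Odd p.1)),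
    dmn N k l r p.1 p.2

/-- The set `A_N(k,l,r)` of lattice points of the polyhedron `P_N(k,l,r)`. -/
def ASet (N : ℕ) (k l r : ℤ) : Set (Fin N → ℤ) :=
  {a | (∀ i, 0 ≤ a i) ∧
       (∀ h : 0 < N, a ⟨0, h⟩ ≤ l) ∧
       (∀ h : 0 < N, a ⟨N - 1, Nat.sub_lt h Nat.one_pos⟩ ≤ r) ∧
       (∀ (t : Fin N) (h : t.1 + 1 < N), a t + a ⟨t.1 + 1, h⟩ ≤ k)}

/-- The lattice-point generating polynomial `p_N(k,l,r;q,z) = ∑_{a ∈ A_N(k,l,r)}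
q^{φ_q(a)} z^{φ_z(a)}`, regarded as an element of `ℚ(q,z)` (the set `A_N(k,l,r)`
is finite, and `∑ᶠ` is the sum over it). -/
def pPoly (N : ℕ) (k l r : ℤ) : K :=
  ∑ᶠ a ∈ ASet N k l r, qK ^ phiQ N a * zK ^ phiZ N a

/-- The pair `(q, z)` avoids every zero and pole of the vertex contributions. -/
structure IsGenericPair {F : Type*} [Field F] (q z : F) : Prop where
  q_ne_zero : q ≠ 0
  z_ne_zero : z ≠ 0
  zpow_ne_one : ∀ i : ℤ, i ≠ 0 → q ^ i ≠ 1
  zpow_mul_ne_one : ∀ i : ℤ, q ^ i * z ≠ 1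

lemma IsGenericPair.shift {F : Type*} [Field F] {q z : F} (h : IsGenericPair q z) :
    IsGenericPair q (q * z) where
  q_ne_zero := h.q_ne_zero
  z_ne_zero := mul_ne_zero h.q_ne_zero h.z_ne_zero
  zpow_ne_one := h.zpow_ne_one
  zpow_mul_ne_one i := by
    rw [← mul_assoc, ← zpow_add_one₀ h.q_ne_zero]
    exact h.zpow_mul_ne_one (i + 1)

lemma IsGenericPair.zpow_mul_inv_ne_one {F : Type*} [Field F] {q z : F}
    (h : IsGenericPair q z) (i : ℤ) : q ^ i * z⁻¹ ≠ 1 := by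
  intro hi
  apply h.zpow_mul_ne_one (-i)
  rw [zpow_neg, ← inv_inj, mul_inv, inv_inv, hi, inv_one]

/-- The denominator of `dmn`, for parameters in an arbitrary field. -/
def vertexDenom {F : Type*} [Field F] (q z : F) (N m n : ℕ) : F :=
  (∏ i ∈ Finset.Icc 1 (m / 2), (1 - q ^ (i : ℤ))) *
    (∏ i ∈ Finset.Icc (m / 2 + 1) m, (1 - q ^ (-(i : ℤ)) * z⁻¹)) *
    (∏ i ∈ Finset.Icc (m + 1) (N - n), (1 - q ^ (i : ℤ) * z)) *
    (∏ i ∈ Finset.Icc 1 (n / 2), (1 - q ^ (-(i : ℤ)))) *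
    (∏ i ∈ Finset.Icc (n / 2 + 1) n, (1 - q ^ ((i : ℤ) - N - 1) * z⁻¹))

/-- The monomial attached to an integer vector. -/
def latticeMonomial {F : Type*} [Field F] (q z : F) (N : ℕ) (a : Fin N → ℤ) : F :=
  q ^ phiQ N a * z ^ phiZ N a

/-- The vertex contribution `dmn`, for parameters in an arbitrary field. -/
def vertexTerm {F : Type*} [Field F] (q z : F) (N : ℕ) (k l r : ℤ) (m n : ℕ) : F :=
  latticeMonomial q z N (Mvec N k l r m n) / vertexDenom q z N m n

lemma prod_Icc_add_one {M : Type*} [CommMonoid M] (f : ℕ → M) (a b : ℕ) :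
    ∏ i ∈ Finset.Icc (a + 1) (b + 1), f i = ∏ i ∈ Finset.Icc a b, f (i + 1) := by
  rw [← Finset.map_add_right_Icc, Finset.prod_map]
  rfl

/-- The factor by which the denominator grows when a coordinate is prepended. -/
def leftFactor {F : Type*} [Field F] (q z : F) (m : ℕ) : F :=
  if Even m then 1 - q ^ ((m / 2 : ℕ) : ℤ) else 1 - q ^ (-((m / 2 : ℕ) + 1 : ℤ)) * z⁻¹

/-- The factor by which the denominator grows when a coordinate is appended. -/
def rightFactor {F : Type*} [Field F] (q z : F) (N n : ℕ) : F :=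
  if Even n then 1 - q ^ (-((n / 2 : ℕ) : ℤ)) else 1 - q ^ ((n / 2 : ℕ) - N : ℤ) * z⁻¹

lemma leftFactor_ne_zero {F : Type*} [Field F] {q z : F} (h : IsGenericPair q z) (m : ℕ) :
    leftFactor q z (m + 1) ≠ 0 := by
  unfold leftFactor
  split_ifs with hm
  · refine sub_ne_zero.2 (h.zpow_ne_one _ ?_).symm
    obtain ⟨s, hs⟩ := hm
    omega
  · exact sub_ne_zero.2 (h.zpow_mul_inv_ne_one _).symm

lemma rightFactor_ne_zero {F : Type*} [Field F] {q z : F} (h : IsGenericPair q z) (N n : ℕ) :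
    rightFactor q z N (n + 1) ≠ 0 := by
  unfold rightFactor
  split_ifs with hn
  · refine sub_ne_zero.2 (h.zpow_ne_one _ ?_).symm
    obtain ⟨s, hs⟩ := hn
    omega
  · exact sub_ne_zero.2 (h.zpow_mul_inv_ne_one _).symm

lemma vertexDenom_ne_zero {F : Type*} [Field F] {q z : F} (h : IsGenericPair q z)
    (N m n : ℕ) : vertexDenom q z N m n ≠ 0 := by
  unfold vertexDenom
  refine mul_ne_zero (mul_ne_zero (mul_ne_zero (mul_ne_zero ?_ ?_) ?_) ?_) ?_ <;>
    refine Finset.prod_ne_zero_iff.2 fun i hi => sub_ne_zero.2 (Ne.symm ?_) <;>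
    rw [Finset.mem_Icc] at hi
  · exact h.zpow_ne_one _ (by omega)
  · exact h.zpow_mul_inv_ne_one _
  · exact h.zpow_mul_ne_one _
  · exact h.zpow_ne_one _ (by omega)
  · exact h.zpow_mul_inv_ne_one _

lemma vertexDenom_succ_left {F : Type*} [Field F] {q z : F} (h : IsGenericPair q z)
    {N m n : ℕ} (hmn : m + n ≤ N) :
    vertexDenom q z (N + 1) (m + 1) n = leftFactor q z (m + 1) * vertexDenom q (q * z) N m n := by
  have hinv (i : ℤ) : q ^ i * (q * z)⁻¹ = q ^ (i - 1) * z⁻¹ := by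
    rw [zpow_sub_one₀ h.q_ne_zero, mul_inv, mul_assoc]
  have hmid : ∏ i ∈ Finset.Icc (m + 1 + 1) (N + 1 - n), (1 - q ^ (i : ℤ) * z) =
      ∏ i ∈ Finset.Icc (m + 1) (N - n), (1 - q ^ (i : ℤ) * (q * z)) := by
    rw [show N + 1 - n = N - n + 1 by omega, prod_Icc_add_one]
    refine Finset.prod_congr rfl fun i _ => ?_
    rw [← mul_assoc, ← zpow_add_one₀ h.q_ne_zero, Nat.cast_succ]
  have hshift (a b : ℕ) : ∏ i ∈ Finset.Icc a b, (1 - q ^ (-(i : ℤ)) * (q * z)⁻¹) =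
      ∏ i ∈ Finset.Icc (a + 1) (b + 1), (1 - q ^ (-(i : ℤ)) * z⁻¹) := by
    rw [prod_Icc_add_one]
    refine Finset.prod_congr rfl fun i _ => ?_
    rw [hinv, Nat.cast_succ, neg_add']
  have hleft : (∏ i ∈ Finset.Icc 1 ((m + 1) / 2), (1 - q ^ (i : ℤ))) *
      (∏ i ∈ Finset.Icc ((m + 1) / 2 + 1) (m + 1), (1 - q ^ (-(i : ℤ)) * z⁻¹)) =
      leftFactor q z (m + 1) * ((∏ i ∈ Finset.Icc 1 (m / 2), (1 - q ^ (i : ℤ))) *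
      (∏ i ∈ Finset.Icc (m / 2 + 1) m, (1 - q ^ (-(i : ℤ)) * (q * z)⁻¹))) := by
    rw [hshift]
    rcases Nat.even_or_odd' m with ⟨s, rfl | rfl⟩
    · have hs : ¬ Even (2 * s + 1) := by simp
      rw [leftFactor, if_neg hs, show (2 * s + 1) / 2 = s by omega, show 2 * s / 2 = s by omega,
        ← Finset.mul_prod_Ioc_eq_prod_Icc (show s + 1 ≤ 2 * s + 1 by omega),
        ← Finset.Icc_add_one_left_eq_Ioc]
      push_cast
      ring
    · have hs : Even (2 * s + 1 + 1) := ⟨s + 1, by omega⟩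
      rw [leftFactor, if_pos hs, show (2 * s + 1 + 1) / 2 = s + 1 by omega,
        show (2 * s + 1) / 2 = s by omega, Finset.prod_Icc_succ_top (by omega)]
      ring
  have hright : ∏ i ∈ Finset.Icc (n / 2 + 1) n,
      (1 - q ^ ((i : ℤ) - (N + 1 : ℕ) - 1) * z⁻¹) =
      ∏ i ∈ Finset.Icc (n / 2 + 1) n, (1 - q ^ ((i : ℤ) - N - 1) * (q * z)⁻¹) := by
    refine Finset.prod_congr rfl fun i _ => ?_
    rw [hinv, Nat.cast_succ, sub_add_eq_sub_sub]
  unfold vertexDenom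
  rw [hleft, hmid, hright]
  ring

lemma vertexDenom_succ_right {F : Type*} [Field F] (q z : F) (N m n : ℕ) :
    vertexDenom q z (N + 1) m (n + 1) =
      rightFactor q z (N + 1) (n + 1) * vertexDenom q z N m n := by
  have hshift (a b : ℕ) : ∏ i ∈ Finset.Icc a b, (1 - q ^ ((i : ℤ) - N - 1) * z⁻¹) =
      ∏ i ∈ Finset.Icc (a + 1) (b + 1), (1 - q ^ ((i : ℤ) - (N + 1 : ℕ) - 1) * z⁻¹) := by
    rw [prod_Icc_add_one]
    refine Finset.prod_congr rfl fun i _ => ?_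
    rw [Nat.cast_succ, Nat.cast_succ, add_sub_add_right_eq_sub]
  have hright : (∏ i ∈ Finset.Icc 1 ((n + 1) / 2), (1 - q ^ (-(i : ℤ)))) *
      (∏ i ∈ Finset.Icc ((n + 1) / 2 + 1) (n + 1),
        (1 - q ^ ((i : ℤ) - (N + 1 : ℕ) - 1) * z⁻¹)) =
      rightFactor q z (N + 1) (n + 1) * ((∏ i ∈ Finset.Icc 1 (n / 2), (1 - q ^ (-(i : ℤ)))) *
      (∏ i ∈ Finset.Icc (n / 2 + 1) n, (1 - q ^ ((i : ℤ) - N - 1) * z⁻¹))) := by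
    rw [hshift]
    rcases Nat.even_or_odd' n with ⟨s, rfl | rfl⟩
    · have hs : ¬ Even (2 * s + 1) := by simp
      rw [rightFactor, if_neg hs, show (2 * s + 1) / 2 = s by omega,
        show 2 * s / 2 = s by omega,
        ← Finset.mul_prod_Ioc_eq_prod_Icc (show s + 1 ≤ 2 * s + 1 by omega),
        ← Finset.Icc_add_one_left_eq_Ioc,
        show ((s + 1 : ℕ) : ℤ) - (N + 1 : ℕ) - 1 = s - (N + 1 : ℕ) by push_cast; ring]
      ring
    · have hs : Even (2 * s + 1 + 1) := ⟨s + 1, by omega⟩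
      rw [rightFactor, if_pos hs, show (2 * s + 1 + 1) / 2 = s + 1 by omega,
        show (2 * s + 1) / 2 = s by omega, Finset.prod_Icc_succ_top (by omega)]
      ring
  unfold vertexDenom
  rw [Nat.add_sub_add_right, mul_assoc, hright]
  ring

lemma phiZ_cons (N : ℕ) (c : ℤ) (a : Fin N → ℤ) :
    phiZ (N + 1) (Fin.cons c a) = c + phiZ N a := by
  simp [phiZ, Fin.sum_univ_succ]

lemma phiQ_cons (N : ℕ) (c : ℤ) (a : Fin N → ℤ) :
    phiQ (N + 1) (Fin.cons c a) = c + (phiQ N a + phiZ N a) := by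
  simp [phiQ, phiZ, Fin.sum_univ_succ, ← Finset.sum_add_distrib, add_mul]

lemma phiZ_snoc (N : ℕ) (c : ℤ) (a : Fin N → ℤ) :
    phiZ (N + 1) (Fin.snoc a c : Fin (N + 1) → ℤ) = phiZ N a + c := by
  simp [phiZ, Fin.sum_univ_castSucc]

lemma phiQ_snoc (N : ℕ) (c : ℤ) (a : Fin N → ℤ) :
    phiQ (N + 1) (Fin.snoc a c : Fin (N + 1) → ℤ) = phiQ N a + (N + 1) * c := by
  simp [phiQ, Fin.sum_univ_castSucc]

lemma latticeMonomial_cons {F : Type*} [Field F] {q z : F} (h : IsGenericPair q z) (N : ℕ)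
    (c : ℤ) (a : Fin N → ℤ) :
    latticeMonomial q z (N + 1) (Fin.cons c a) =
      (q * z) ^ c * latticeMonomial q (q * z) N a := by
  have hq := h.q_ne_zero
  have hz := h.z_ne_zero
  simp only [latticeMonomial, phiQ_cons, phiZ_cons, zpow_add₀ hq, zpow_add₀ hz, mul_zpow]
  ring

lemma latticeMonomial_snoc {F : Type*} [Field F] {q z : F} (h : IsGenericPair q z) (N : ℕ)
    (c : ℤ) (a : Fin N → ℤ) :
    latticeMonomial q z (N + 1) (Fin.snoc a c : Fin (N + 1) → ℤ) =
      (q ^ (N + 1) * z) ^ c * latticeMonomial q z N a := by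
  have hq := h.q_ne_zero
  have hz := h.z_ne_zero
  simp only [latticeMonomial, phiQ_snoc, phiZ_snoc, zpow_add₀ hq, zpow_add₀ hz, mul_zpow,
    zpow_mul, ← zpow_natCast q (N + 1), Nat.cast_succ]
  ring

lemma Mvec_succ_left {N m n : ℕ} (k l r : ℤ) (hmn : m + n ≤ N) :
    Mvec (N + 1) k l r (m + 1) n = Fin.cons l (Mvec N k (k - l) r m n) := by
  ext j
  refine Fin.cases ?_ (fun i => ?_) j
  · simp [Mvec]
  · have hi := i.2
    simp only [Mvec, Fin.cons_succ, Fin.val_succ]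
    split_ifs <;> omega

lemma Mvec_succ_right {N m n : ℕ} (k l r : ℤ) (hmn : m + n ≤ N) :
    Mvec (N + 1) k l r m (n + 1) =
      (Fin.snoc (Mvec N k l (k - r) m n) r : Fin (N + 1) → ℤ) := by
  ext j
  refine Fin.lastCases ?_ (fun i => ?_) j
  · simp only [Mvec, Fin.snoc_last, Fin.val_last]
    split_ifs <;> omega
  · have hi := i.2
    simp only [Mvec, Fin.snoc_castSucc, Fin.val_castSucc]
    split_ifs <;> omega

lemma Mvec_zero_left (N : ℕ) (k l l' r : ℤ) (n : ℕ) :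
    Mvec N k l r 0 n = Mvec N k l' r 0 n := by
  ext j
  simp only [Mvec]
  split_ifs <;> omega

lemma Mvec_zero_right (N : ℕ) (k l r r' : ℤ) (m : ℕ) :
    Mvec N k l r m 0 = Mvec N k l r' m 0 := by
  ext j
  have hj := j.2
  simp only [Mvec]
  split_ifs <;> omega

lemma phi_Mvec_sub_one_left {N m n : ℕ} (k l r : ℤ) (hmn : m + n ≤ N) :
    phiZ N (Mvec N k (l - 1) r m n) =
        phiZ N (Mvec N k l r m n) - (if Even m then 0 else 1) ∧
      phiQ N (Mvec N k (l - 1) r m n) =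
        phiQ N (Mvec N k l r m n) -
          (if Even m then -((m / 2 : ℕ) : ℤ) else (m / 2 : ℕ) + 1) := by
  induction m generalizing N l with
  | zero => simp [Mvec_zero_left N k (l - 1) l r n]
  | succ m ih =>
    obtain ⟨N, rfl⟩ : ∃ N', N = N' + 1 := ⟨N - 1, by omega⟩
    have hmn' : m + n ≤ N := by omega
    have hprev := ih (k - (l - 1)) hmn'
    rw [show k - (l - 1) - 1 = k - l by ring] at hprev
    obtain ⟨hZ, hQ⟩ := hprev
    rw [Mvec_succ_left k l r hmn', Mvec_succ_left k (l - 1) r hmn', phiZ_cons, phiZ_cons,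
      phiQ_cons, phiQ_cons, hZ, hQ]
    simp only [Nat.even_add_one]
    rcases Nat.even_or_odd' m with ⟨s, rfl | rfl⟩
    · simp only [even_two_mul, not_true_eq_false, if_true, if_false]
      constructor <;> omega
    · have hs : ¬ Even (2 * s + 1) := by simp
      simp only [hs, not_false_eq_true, if_true, if_false]
      constructor <;> omega

lemma phi_Mvec_sub_one_right {N m n : ℕ} (k l r : ℤ) (hmn : m + n ≤ N) :
    phiZ N (Mvec N k l (r - 1) m n) =
        phiZ N (Mvec N k l r m n) - (if Even n then 0 else 1) ∧
      phiQ N (Mvec N k l (r - 1) m n) =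
        phiQ N (Mvec N k l r m n) -
          (if Even n then ((n / 2 : ℕ) : ℤ) else N - (n / 2 : ℕ)) := by
  induction n generalizing N r with
  | zero => simp [Mvec_zero_right N k l (r - 1) r m]
  | succ n ih =>
    obtain ⟨N, rfl⟩ : ∃ N', N = N' + 1 := ⟨N - 1, by omega⟩
    have hmn' : m + n ≤ N := by omega
    have hprev := ih (k - (r - 1)) hmn'
    rw [show k - (r - 1) - 1 = k - r by ring] at hprev
    obtain ⟨hZ, hQ⟩ := hprev
    rw [Mvec_succ_right k l r hmn', Mvec_succ_right k l (r - 1) hmn', phiZ_snoc, phiZ_snoc,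
      phiQ_snoc, phiQ_snoc, hZ, hQ, mul_sub]
    simp only [Nat.even_add_one]
    rcases Nat.even_or_odd' n with ⟨s, rfl | rfl⟩
    · simp only [even_two_mul, not_true_eq_false, if_true, if_false]
      constructor <;> omega
    · have hs : ¬ Even (2 * s + 1) := by simp
      simp only [hs, not_false_eq_true, if_true, if_false]
      constructor <;> omega

lemma latticeMonomial_Mvec_sub_one_left {F : Type*} [Field F] {q z : F}
    (h : IsGenericPair q z) {N m n : ℕ} (k l r : ℤ) (hmn : m + n ≤ N) :
    latticeMonomial q z N (Mvec N k (l - 1) r m n) =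
      (1 - leftFactor q z m) * latticeMonomial q z N (Mvec N k l r m n) := by
  obtain ⟨hZ, hQ⟩ := phi_Mvec_sub_one_left k l r hmn
  rw [latticeMonomial, hZ, hQ, zpow_sub₀ h.q_ne_zero, zpow_sub₀ h.z_ne_zero, leftFactor,
    latticeMonomial]
  split_ifs
  · simp [zpow_neg]
    ring
  · rw [zpow_neg, zpow_one, sub_sub_cancel]
    ring

lemma latticeMonomial_Mvec_sub_one_right {F : Type*} [Field F] {q z : F}
    (h : IsGenericPair q z) {N m n : ℕ} (k l r : ℤ) (hmn : m + n ≤ N) :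
    latticeMonomial q z N (Mvec N k l (r - 1) m n) =
      (1 - rightFactor q z N n) * latticeMonomial q z N (Mvec N k l r m n) := by
  obtain ⟨hZ, hQ⟩ := phi_Mvec_sub_one_right k l r hmn
  rw [latticeMonomial, hZ, hQ, zpow_sub₀ h.q_ne_zero, zpow_sub₀ h.z_ne_zero, rightFactor,
    latticeMonomial]
  split_ifs
  · simp [zpow_neg]
    ring
  · rw [← neg_sub (N : ℤ), zpow_neg, zpow_one, sub_sub_cancel]
    ring

lemma vertexTerm_zero_left {F : Type*} [Field F] (q z : F) (N : ℕ) (k l l' r : ℤ) (n : ℕ) :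
    vertexTerm q z N k l r 0 n = vertexTerm q z N k l' r 0 n := by
  rw [vertexTerm, Mvec_zero_left N k l l' r n, vertexTerm]

lemma vertexTerm_zero_right {F : Type*} [Field F] (q z : F) (N : ℕ) (k l r r' : ℤ) (m : ℕ) :
    vertexTerm q z N k l r m 0 = vertexTerm q z N k l r' m 0 := by
  rw [vertexTerm, Mvec_zero_right N k l r r' m, vertexTerm]

lemma vertexTerm_sub_left {F : Type*} [Field F] {q z : F} (h : IsGenericPair q z)
    {N m n : ℕ} (k l r : ℤ) (hmn : m + n ≤ N) :
    vertexTerm q z (N + 1) k l r (m + 1) n - vertexTerm q z (N + 1) k (l - 1) r (m + 1) n =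
      (q * z) ^ l * vertexTerm q (q * z) N k (k - l) r m n := by
  have hf := leftFactor_ne_zero h m
  have hD := vertexDenom_ne_zero h.shift N m n
  rw [vertexTerm, vertexTerm, latticeMonomial_Mvec_sub_one_left h k l r (by omega),
    vertexDenom_succ_left h hmn, Mvec_succ_left k l r hmn, latticeMonomial_cons h, vertexTerm]
  field_simp
  ring

lemma vertexTerm_sub_right {F : Type*} [Field F] {q z : F} (h : IsGenericPair q z)
    {N m n : ℕ} (k l r : ℤ) (hmn : m + n ≤ N) :
    vertexTerm q z (N + 1) k l r m (n + 1) - vertexTerm q z (N + 1) k l (r - 1) m (n + 1) =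
      (q ^ (N + 1) * z) ^ r * vertexTerm q z N k l (k - r) m n := by
  have hf := rightFactor_ne_zero h (N + 1) n
  have hD := vertexDenom_ne_zero h N m n
  rw [vertexTerm, vertexTerm, latticeMonomial_Mvec_sub_one_right h k l r (by omega),
    vertexDenom_succ_right, Mvec_succ_right k l r hmn, latticeMonomial_snoc h, vertexTerm]
  field_simp
  ring

/-- The sum of the vertex contributions, with weight `α` when `m + n < N` and weight `c m` when
`m + n = N`. -/
def vertexSum {F : Type*} [Field F] (q z : F) (N : ℕ) (k l r : ℤ) (α : F) (c : ℕ → F) : F :=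
  ∑ m ∈ Finset.range (N + 1), ∑ n ∈ Finset.range (N + 1),
    (if m + n < N then α else if m + n = N then c m else 0) * vertexTerm q z N k l r m n

lemma vertexSum_sub_left {F : Type*} [Field F] {q z : F} (h : IsGenericPair q z)
    (N : ℕ) (k l r : ℤ) (α : F) (c : ℕ → F) :
    vertexSum q z (N + 1) k l r α c - vertexSum q z (N + 1) k (l - 1) r α c =
      (q * z) ^ l * vertexSum q (q * z) N k (k - l) r α fun m => c (m + 1) := by
  simp only [vertexSum]
  rw [← Finset.sum_sub_distrib, Finset.sum_range_succ', Finset.mul_sum]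
  simp only [← Finset.sum_sub_distrib, ← mul_sub]
  simp only [vertexTerm_zero_left q z (N + 1) k l (l - 1) r, sub_self, mul_zero,
    Finset.sum_const_zero, add_zero]
  refine Finset.sum_congr rfl fun m _ => ?_
  rw [Finset.sum_range_succ, if_neg (by omega), if_neg (by omega), zero_mul, add_zero,
    Finset.mul_sum]
  refine Finset.sum_congr rfl fun n _ => ?_
  by_cases hmn : m + n ≤ N
  · rw [vertexTerm_sub_left h k l r hmn]
    simp only [show m + 1 + n < N + 1 ↔ m + n < N by omega,
      show m + 1 + n = N + 1 ↔ m + n = N by omega]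
    ring
  · rw [if_neg (by omega), if_neg (by omega), if_neg (by omega), if_neg (by omega)]
    simp

lemma vertexSum_sub_right {F : Type*} [Field F] {q z : F} (h : IsGenericPair q z)
    (N : ℕ) (k l r : ℤ) (α : F) (c : ℕ → F) :
    vertexSum q z (N + 1) k l r α c - vertexSum q z (N + 1) k l (r - 1) α c =
      (q ^ (N + 1) * z) ^ r * vertexSum q z N k l (k - r) α c := by
  simp only [vertexSum]
  rw [← Finset.sum_sub_distrib, Finset.sum_range_succ, Finset.mul_sum]
  simp only [← Finset.sum_sub_distrib, ← mul_sub]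
  rw [Finset.sum_eq_zero (s := Finset.range (N + 1 + 1)), add_zero]
  · refine Finset.sum_congr rfl fun m _ => ?_
    rw [Finset.sum_range_succ', vertexTerm_zero_right q z (N + 1) k l r (r - 1), sub_self,
      mul_zero, add_zero, Finset.mul_sum]
    refine Finset.sum_congr rfl fun n _ => ?_
    by_cases hmn : m + n ≤ N
    · rw [vertexTerm_sub_right h k l r hmn]
      simp only [show m + (n + 1) < N + 1 ↔ m + n < N by omega,
        show m + (n + 1) = N + 1 ↔ m + n = N by omega]
      ring
    · rw [if_neg (by omega), if_neg (by omega), if_neg (by omega), if_neg (by omega)]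
      simp
  · intro n _
    cases n with
    | zero => rw [vertexTerm_zero_right q z (N + 1) k l r (r - 1), sub_self, mul_zero]
    | succ n => rw [if_neg (by omega), if_neg (by omega), zero_mul]

lemma sum_range_two_mul_eq_zero {M : Type*} [AddCommMonoid M] (f : ℕ → M) (L : ℕ)
    (hf : ∀ s < L, f (2 * s) + f (2 * s + 1) = 0) :
    ∑ m ∈ Finset.range (2 * L), f m = 0 := by
  induction L with
  | zero => simp
  | succ L ih =>
    rw [mul_add, mul_one, Finset.sum_range_succ, Finset.sum_range_succ,
      ih fun s hs => hf s (by omega), zero_add, hf L (by omega)]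

lemma latticeMonomial_Mvec_succ {F : Type*} [Field F] {q z : F} (h : IsGenericPair q z)
    {N s n : ℕ} (k l r : ℤ) (hmn : 2 * s + 1 + n ≤ N) :
    latticeMonomial q z N (Mvec N k l r (2 * s + 1) n) =
      (q ^ (2 * s + 1) * z) ^ l * latticeMonomial q z N (Mvec N k l r (2 * s) n) := by
  have hM : Mvec N k l r (2 * s + 1) n =
      fun j => Mvec N k l r (2 * s) n j + if j = (⟨2 * s, by omega⟩ : Fin N) then l else 0 := by
    ext j
    have hj := j.2
    simp only [Mvec, Fin.ext_iff]
    split_ifs <;> omega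
  have hZ : phiZ N (Mvec N k l r (2 * s + 1) n) = phiZ N (Mvec N k l r (2 * s) n) + l := by
    simp [hM, phiZ, Finset.sum_add_distrib]
  have hQ : phiQ N (Mvec N k l r (2 * s + 1) n) =
      phiQ N (Mvec N k l r (2 * s) n) + (2 * s + 1 : ℕ) * l := by
    simp [hM, phiQ, Finset.sum_add_distrib, mul_add]
  rw [latticeMonomial, hZ, hQ, zpow_add₀ h.q_ne_zero, zpow_add₀ h.z_ne_zero, mul_zpow, zpow_mul,
    zpow_natCast, latticeMonomial]
  ring

lemma vertexDenom_two_mul_succ {F : Type*} [Field F] (q z : F)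
    {N s n : ℕ} (hmn : 2 * s + 1 + n ≤ N) :
    vertexDenom q z N (2 * s + 1) n * (1 - q ^ (2 * s + 1) * z) =
      vertexDenom q z N (2 * s) n * (1 - (q ^ (2 * s + 1) * z)⁻¹) := by
  unfold vertexDenom
  rw [show (2 * s + 1) / 2 = s by omega, show 2 * s / 2 = s by omega,
    Finset.prod_Icc_succ_top (show s + 1 ≤ 2 * s + 1 by omega),
    ← Finset.mul_prod_Ioc_eq_prod_Icc (show 2 * s + 1 ≤ N - n by omega),
    ← Finset.Icc_add_one_left_eq_Ioc, zpow_neg, zpow_natCast, mul_inv]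
  ring

/-- The contributions of the vertices `(2s, n)` and `(2s+1, n)` cancel at `l = -1`. -/
lemma vertexTerm_two_mul_add_succ {F : Type*} [Field F] {q z : F} (h : IsGenericPair q z)
    {N s n : ℕ} (k r : ℤ) (hmn : 2 * s + 1 + n ≤ N) :
    vertexTerm q z N k (-1) r (2 * s) n + vertexTerm q z N k (-1) r (2 * s + 1) n = 0 := by
  have hx : q ^ (2 * s + 1) * z ≠ 0 := mul_ne_zero (pow_ne_zero _ h.q_ne_zero) h.z_ne_zero
  have hD := vertexDenom_two_mul_succ q z hmn
  have hD₀ := vertexDenom_ne_zero h N (2 * s) n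
  have hD₁ := vertexDenom_ne_zero h N (2 * s + 1) n
  have hx₁ : 1 - q ^ (2 * s + 1) * z ≠ 0 := by
    have := h.zpow_mul_ne_one (2 * s + 1 : ℕ)
    rw [zpow_natCast] at this
    exact sub_ne_zero.2 this.symm
  rw [vertexTerm, vertexTerm, latticeMonomial_Mvec_succ h k (-1) r hmn, zpow_neg_one]
  generalize q ^ (2 * s + 1) * z = x at *
  generalize latticeMonomial q z N (Mvec N k (-1) r (2 * s) n) = a
  rw [div_add_div _ _ hD₀ hD₁, div_eq_zero_iff]
  left
  apply mul_left_cancel₀ hx₁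
  linear_combination a * hD + a * vertexDenom q z N (2 * s) n * mul_inv_cancel₀ hx * (-1)

lemma vertexSum_neg_one {F : Type*} [Field F] {q z : F} (h : IsGenericPair q z)
    (N : ℕ) (k r : ℤ) :
    vertexSum q z N k (-1) r 1 (fun m => if Even m then 0 else 1) = 0 := by
  rw [vertexSum, Finset.sum_comm]
  refine Finset.sum_eq_zero fun n _ => ?_
  rw [Finset.sum_subset (Finset.range_subset_range.2 (show N + 1 ≤ 2 * (N + 1) by omega))]
  · refine sum_range_two_mul_eq_zero _ _ fun s _ => ?_
    have hs : ¬ Even (2 * s + 1) := by simp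
    rw [if_pos (even_two_mul s), if_neg hs]
    by_cases hmn : 2 * s + 1 + n ≤ N
    · rw [if_pos (by omega), ite_eq_left_iff.2 (fun h' => if_pos (by omega)), one_mul, one_mul,
        vertexTerm_two_mul_add_succ h k r hmn]
    · rw [if_neg (by omega), ite_self, if_neg (by omega), if_neg (by omega)]
      simp
  · intro m _ hm
    rw [Finset.mem_range] at hm
    rw [if_neg (by omega), if_neg (by omega), zero_mul]

lemma vertexSum_zero_weight {F : Type*} [Field F] (q z : F) (N : ℕ) (k l r : ℤ) (c : ℕ → F) :
    vertexSum q z N k l r 0 c =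
      ∑ m ∈ Finset.range (N + 1), c m * vertexTerm q z N k l r m (N - m) := by
  refine Finset.sum_congr rfl fun m hm => ?_
  rw [Finset.mem_range] at hm
  rw [Finset.sum_eq_single_of_mem (N - m) (Finset.mem_range.2 (by omega))]
  · rw [if_neg (by omega), if_pos (by omega)]
  · intro n _ hn
    rw [if_neg (show ¬ m + n = N by omega), ite_self, zero_mul]

/-- The value of `l` at which all vertices with `m + n = N` coincide. -/
def wall (N : ℕ) (k r : ℤ) : ℤ := if Even N then k - r else r

lemma wall_succ (N : ℕ) (k r : ℤ) : wall (N + 1) k r = k - wall N k r := by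
  simp only [wall, Nat.even_add_one]
  split_ifs <;> simp_all

lemma Mvec_wall {N m : ℕ} (k r : ℤ) (hm : m ≤ N) :
    Mvec N k (wall N k r) r m (N - m) = Mvec N k (wall N k r) r N 0 := by
  ext j
  have hj := j.2
  simp only [Mvec, wall, Nat.even_iff]
  split_ifs <;> omega

lemma vertexDenom_two_mul_two_mul_add_one {F : Type*} [Field F] (q z : F) (s t : ℕ) :
    vertexDenom q z (2 * (s + t) + 1) (2 * s) (2 * t + 1) =
      vertexDenom q z (2 * (s + t) + 1) (2 * s + 1) (2 * t) := by
  unfold vertexDenom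
  rw [show (2 * s + 1) / 2 = s by omega, show 2 * s / 2 = s by omega,
    show (2 * t + 1) / 2 = t by omega, show 2 * t / 2 = t by omega,
    Finset.prod_Icc_succ_top (show s + 1 ≤ 2 * s + 1 by omega),
    Finset.prod_Icc_succ_top (show t + 1 ≤ 2 * t + 1 by omega),
    Finset.Icc_eq_empty (show ¬ 2 * s + 1 ≤ 2 * (s + t) + 1 - (2 * t + 1) by omega),
    Finset.Icc_eq_empty (show ¬ 2 * s + 1 + 1 ≤ 2 * (s + t) + 1 - 2 * t by omega),
    show ((2 * t + 1 : ℕ) : ℤ) - (2 * (s + t) + 1 : ℕ) - 1 = -(2 * s + 1 : ℕ) by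
      push_cast; ring]
  ring

lemma vertexSum_wall_odd {F : Type*} [Field F] (q z : F) (M : ℕ) (k r : ℤ) {c : ℕ → F}
    (hc : ∀ m, c (m + 1) = -c m) :
    vertexSum q z (2 * M + 1) k (wall (2 * M + 1) k r) r 0 c = 0 := by
  rw [vertexSum_zero_weight, show 2 * M + 1 + 1 = 2 * (M + 1) by omega]
  refine sum_range_two_mul_eq_zero _ _ fun s hs => ?_
  obtain ⟨t, rfl⟩ : ∃ t, M = s + t := ⟨M - s, by omega⟩
  rw [hc, vertexTerm, vertexTerm, Mvec_wall k r (by omega), Mvec_wall k r (by omega),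
    show 2 * (s + t) + 1 - 2 * s = 2 * t + 1 by omega,
    show 2 * (s + t) + 1 - (2 * s + 1) = 2 * t by omega, vertexDenom_two_mul_two_mul_add_one]
  ring

lemma vertexSum_wall_even {F : Type*} [Field F] {q z : F} (h : IsGenericPair q z) (M : ℕ)
    (k r : ℤ) {c : ℕ → F} (hc : ∀ m, c (m + 1) = -c m) :
    vertexSum q z (2 * M + 1 + 1) k (wall (2 * M + 1 + 1) k r) r 0 c = 0 := by
  have hwall (r : ℤ) : wall (2 * M + 1 + 1) k r = k - r :=
    if_pos (show Even (2 * M + 1 + 1) from ⟨M + 1, by omega⟩)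
  have hodd (r : ℤ) : wall (2 * M + 1) k r = r := if_neg (by simp)
  have hr := vertexSum_sub_right h (2 * M + 1) k (k - (r + 1)) (r + 1) 0 c
  have hl := vertexSum_sub_left h (2 * M + 1) k (k - r) r 0 c
  have hwr := vertexSum_wall_odd q z M k (k - (r + 1)) hc
  have hwl := vertexSum_wall_odd q (q * z) M k r (c := fun m => c (m + 1)) fun m => hc (m + 1)
  rw [hodd] at hwr hwl
  rw [hwr, mul_zero, add_sub_cancel_right] at hr
  rw [sub_sub_cancel, hwl, mul_zero, sub_sub] at hl
  have hscale : vertexSum q z (2 * M + 1 + 1) k (k - (r + 1)) (r + 1) 0 c =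
      (1 - leftFactor q z (2 * M + 1 + 1)) *
        vertexSum q z (2 * M + 1 + 1) k (k - r) r 0 c := by
    rw [vertexSum_zero_weight, vertexSum_zero_weight, Finset.mul_sum]
    refine Finset.sum_congr rfl fun m hm => ?_
    have hm' : m ≤ 2 * M + 1 + 1 := Nat.lt_succ_iff.1 (Finset.mem_range.1 hm)
    rw [vertexTerm, vertexTerm, ← hwall, ← hwall, Mvec_wall k _ hm', Mvec_wall k _ hm', hwall,
      hwall, Mvec_zero_right _ k _ (r + 1) r, ← sub_sub k r 1,
      latticeMonomial_Mvec_sub_one_left h k (k - r) r (Nat.add_zero _).le]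
    ring
  have hzero : leftFactor q z (2 * M + 1 + 1) *
      vertexSum q z (2 * M + 1 + 1) k (k - r) r 0 c = 0 := by
    linear_combination hl - hr + hscale
  rw [hwall]
  exact (mul_eq_zero.1 hzero).resolve_left (leftFactor_ne_zero h _)

lemma vertexSum_wall {F : Type*} [Field F] {q z : F} (h : IsGenericPair q z) (N : ℕ)
    (k r : ℤ) {c : ℕ → F} (hc : ∀ m, c (m + 1) = -c m) :
    vertexSum q z (N + 1) k (wall (N + 1) k r) r 0 c = 0 := by
  rcases Nat.even_or_odd' N with ⟨M, rfl | rfl⟩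
  · exact vertexSum_wall_odd q z M k r hc
  · exact vertexSum_wall_even h M k r hc

lemma vertexSum_sub {F : Type*} [Field F] (q z : F) (N : ℕ) (k l r : ℤ) (α β : F)
    (c d : ℕ → F) :
    vertexSum q z N k l r α c - vertexSum q z N k l r β d =
      vertexSum q z N k l r (α - β) fun m => c m - d m := by
  simp only [vertexSum, ← Finset.sum_sub_distrib, ← sub_mul]
  refine Finset.sum_congr rfl fun m _ => Finset.sum_congr rfl fun n _ => ?_
  split_ifs <;> simp

/-- The generalization of `dE` to parameters in an arbitrary field. -/
def evenSum {F : Type*} [Field F] (q z : F) (N : ℕ) (k l r : ℤ) : F :=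
  vertexSum q z N k l r 1 fun m => if Even m then 1 else 0

/-- The generalization of `dO` to parameters in an arbitrary field. -/
def oddSum {F : Type*} [Field F] (q z : F) (N : ℕ) (k l r : ℤ) : F :=
  vertexSum q z N k l r 1 fun m => if Even m then 0 else 1

lemma evenSum_sub {F : Type*} [Field F] {q z : F} (h : IsGenericPair q z) (N : ℕ)
    (k l r : ℤ) :
    evenSum q z (N + 1) k l r - evenSum q z (N + 1) k (l - 1) r =
      (q * z) ^ l * oddSum q (q * z) N k (k - l) r := by
  rw [evenSum, evenSum, vertexSum_sub_left h, oddSum]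
  simp only [Nat.even_add_one, ite_not]

lemma oddSum_sub {F : Type*} [Field F] {q z : F} (h : IsGenericPair q z) (N : ℕ)
    (k l r : ℤ) :
    oddSum q z (N + 1) k l r - oddSum q z (N + 1) k (l - 1) r =
      (q * z) ^ l * evenSum q (q * z) N k (k - l) r := by
  rw [oddSum, oddSum, vertexSum_sub_left h, evenSum]
  simp only [Nat.even_add_one, ite_not]

lemma evenSum_wall {F : Type*} [Field F] {q z : F} (h : IsGenericPair q z) (N : ℕ) (k r : ℤ) :
    evenSum q z (N + 1) k (wall (N + 1) k r) r = oddSum q z (N + 1) k (wall (N + 1) k r) r := by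
  rw [← sub_eq_zero, evenSum, oddSum, vertexSum_sub, sub_self]
  refine vertexSum_wall h N k r fun m => ?_
  simp only [Nat.even_add_one, ite_not]
  split_ifs <;> simp

/-- The set `ASet`, except that for `N = 0` the inequality `k ≤ l + r` is imposed; with this
convention prepending a coordinate is described uniformly in `N`. -/
def extendedASet (N : ℕ) (k l r : ℤ) : Set (Fin N → ℤ) :=
  {a | a ∈ ASet N k l r ∧ (N = 0 → k ≤ l + r)}

lemma cons_mem_extendedASet_iff {N : ℕ} {k l r c : ℤ} {b : Fin N → ℤ} :
    (Fin.cons c b : Fin (N + 1) → ℤ) ∈ extendedASet (N + 1) k l r ↔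
      0 ≤ c ∧ c ≤ l ∧ b ∈ extendedASet N k (k - c) r := by
  constructor
  · rintro ⟨⟨h0, hl, hr, hk⟩, -⟩
    refine ⟨h0 0, hl (Nat.succ_pos N), ⟨fun i => h0 i.succ, fun hN => ?_, fun hN => ?_,
      fun t ht => ?_⟩, ?_⟩
    · have := hk 0 (Nat.succ_lt_succ hN)
      change c + b ⟨0, hN⟩ ≤ k at this
      omega
    · obtain ⟨N, rfl⟩ : ∃ N', N = N' + 1 := ⟨N - 1, by omega⟩
      exact hr (Nat.succ_pos _)
    · exact hk t.succ (Nat.succ_lt_succ ht)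
    · rintro rfl
      have : c ≤ r := hr (Nat.succ_pos _)
      omega
  · rintro ⟨h0, hl, ⟨hb0, hbl, hbr, hbk⟩, hN⟩
    refine ⟨⟨Fin.cases h0 hb0, fun _ => hl, fun _ => ?_, Fin.cases (fun ht => ?_) fun t ht => ?_⟩,
      fun h => absurd h (Nat.succ_ne_zero N)⟩
    · cases N with
      | zero =>
        change c ≤ r
        have := hN rfl
        omega
      | succ N => exact hbr (Nat.succ_pos N)
    · have := hbl (Nat.lt_of_succ_lt_succ ht)
      change c + b ⟨0, Nat.lt_of_succ_lt_succ ht⟩ ≤ k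
      omega
    · exact hbk t (Nat.lt_of_succ_lt_succ ht)

lemma extendedASet_finite (N : ℕ) (k l r : ℤ) : (extendedASet N k l r).Finite := by
  refine (Set.finite_Icc (0 : Fin N → ℤ) fun _ => max l k).subset ?_
  rintro a ⟨⟨h0, hl, -, hk⟩, -⟩
  refine ⟨h0, fun i => ?_⟩
  obtain ⟨i, hi⟩ := i
  cases i with
  | zero => exact le_max_of_le_left (hl hi)
  | succ i =>
    have h1 := hk ⟨i, by omega⟩ hi
    have h2 := h0 ⟨i, by omega⟩
    exact le_max_of_le_right (by linarith)

lemma extendedASet_succ (N : ℕ) (k r : ℤ) {l : ℤ} (hl : 0 ≤ l) :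
    extendedASet (N + 1) k l r =
      extendedASet (N + 1) k (l - 1) r ∪
        (fun b : Fin N → ℤ => (Fin.cons l b : Fin (N + 1) → ℤ)) '' extendedASet N k (k - l) r := by
  ext a
  refine Fin.consCases (fun c b => ?_) a
  simp only [Set.mem_union, Set.mem_image, cons_mem_extendedASet_iff, Fin.cons_inj]
  constructor
  · rintro ⟨h0, hc, hb⟩
    rcases hc.lt_or_eq with hc | rfl
    · exact Or.inl ⟨h0, by omega, hb⟩
    · exact Or.inr ⟨b, hb, rfl, rfl⟩
  · rintro (⟨h0, hc, hb⟩ | ⟨b, hb, rfl, rfl⟩)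
    · exact ⟨h0, by omega, hb⟩
    · exact ⟨hl, le_rfl, hb⟩

/-- The generating function of `extendedASet`. -/
def latticeSum {F : Type*} [Field F] (q z : F) (N : ℕ) (k l r : ℤ) : F :=
  ∑ᶠ a ∈ extendedASet N k l r, latticeMonomial q z N a

lemma latticeSum_sub {F : Type*} [Field F] {q z : F} (h : IsGenericPair q z) (N : ℕ)
    (k r : ℤ) {l : ℤ} (hl : 0 ≤ l) :
    latticeSum q z (N + 1) k l r - latticeSum q z (N + 1) k (l - 1) r =
      (q * z) ^ l * latticeSum q (q * z) N k (k - l) r := by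
  have hdisj : Disjoint (extendedASet (N + 1) k (l - 1) r)
      ((fun b : Fin N → ℤ => (Fin.cons l b : Fin (N + 1) → ℤ)) '' extendedASet N k (k - l) r) := by
    rw [Set.disjoint_right]
    rintro _ ⟨b, -, rfl⟩ hb
    have := (cons_mem_extendedASet_iff.1 hb).2.1
    omega
  have hinj : Set.InjOn (fun b : Fin N → ℤ => (Fin.cons l b : Fin (N + 1) → ℤ))
      (extendedASet N k (k - l) r) := fun _ _ _ _ hab => (Fin.cons_inj.1 hab).2
  rw [latticeSum, extendedASet_succ N k r hl,
    finsum_mem_union hdisj (extendedASet_finite _ _ _ _)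
      ((extendedASet_finite _ _ _ _).image _),
    finsum_mem_image hinj, ← latticeSum, add_sub_cancel_left, latticeSum,
    mul_finsum_mem]
  exact finsum_mem_congr rfl fun b _ => latticeMonomial_cons h N l b

lemma latticeSum_neg_one {F : Type*} [Field F] (q z : F) (N : ℕ) (k r : ℤ) :
    latticeSum q z (N + 1) k (-1) r = 0 := by
  have hempty : extendedASet (N + 1) k (-1) r = ∅ := by
    rw [Set.eq_empty_iff_forall_notMem]
    refine fun a => Fin.consCases (fun c b hb => ?_) a
    obtain ⟨h0, h1, -⟩ := cons_mem_extendedASet_iff.1 hb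
    omega
  rw [latticeSum, hempty, finsum_mem_empty]

theorem latticeSum_eq_oddSum_and_evenSum {F : Type*} [Field F] (N : ℕ) {q z : F}
    (h : IsGenericPair q z) {k l r : ℤ} (hl0 : 0 ≤ l) (hlk : l ≤ k) (hr0 : 0 ≤ r)
    (hrk : r ≤ k) :
    (l < wall N k r → latticeSum q z N k l r = oddSum q z N k l r) ∧
      (wall N k r ≤ l → latticeSum q z N k l r = evenSum q z N k l r) := by
  induction N generalizing z l with
  | zero =>
    have hterm : vertexTerm q z 0 k l r 0 0 = 1 := by
      simp [vertexTerm, latticeMonomial, vertexDenom, phiQ, phiZ]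
    have hmem (a : Fin 0 → ℤ) : a ∈ extendedASet 0 k l r ↔ k ≤ l + r := by
      simp [extendedASet, ASet]
    have hwall : wall 0 k r = k - r := if_pos (by simp)
    rw [hwall]
    constructor
    · intro hlt
      have hempty : extendedASet 0 k l r = ∅ :=
        Set.eq_empty_iff_forall_notMem.2 fun a => by rw [hmem]; omega
      rw [latticeSum, hempty, finsum_mem_empty]
      simp [oddSum, vertexSum]
    · intro hle
      have huniv : extendedASet 0 k l r = {0} := by
        ext a
        rw [hmem]
        simp [Subsingleton.elim a 0]
        omega
      rw [latticeSum, huniv, finsum_mem_singleton]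
      simp [evenSum, vertexSum, hterm, latticeMonomial, phiQ, phiZ]
  | succ N ih =>
    have hw := wall_succ N k r
    have hw0 : 0 ≤ wall (N + 1) k r := by
      unfold wall
      split_ifs <;> omega
    have hlow (l : ℤ) (hl : -1 ≤ l) :
        l ≤ k → l ≤ wall (N + 1) k r → latticeSum q z (N + 1) k l r = oddSum q z (N + 1) k l r := by
      induction l, hl using Int.leInduction with
      | base =>
        intro _ _
        rw [latticeSum_neg_one, oddSum, vertexSum_neg_one h]
      | succ l hl ihl =>
        intro hlk hlw
        have hp := latticeSum_sub h N k r (show 0 ≤ l + 1 by omega)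
        have hd := oddSum_sub h N k (l + 1) r
        have hN := (ih h.shift (l := k - (l + 1)) (by omega) (by omega)).2 (by omega)
        rw [add_sub_cancel_right] at hp hd
        rw [hN] at hp
        linear_combination hp - hd + ihl (by omega) (by omega)
    refine ⟨fun hlw => hlow l (by omega) hlk hlw.le, fun hlw => ?_⟩
    induction l, hlw using Int.leInduction with
    | base => rw [hlow _ (by omega) hlk le_rfl, evenSum_wall h]
    | succ l hl ihl =>
      have hp := latticeSum_sub h N k r (show 0 ≤ l + 1 by omega)
      have hd := evenSum_sub h N k (l + 1) r
      have hN := (ih h.shift (l := k - (l + 1)) (by omega) (by omega)).1 (by omega)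
      rw [add_sub_cancel_right] at hp hd
      rw [hN] at hp
      linear_combination hp - hd + ihl (by omega) (by omega)

lemma isGenericPair_qK_zK : IsGenericPair qK zK := by
  have hinj : Function.Injective (algebraMap (MvPolynomial (Fin 2) ℚ) K) :=
    IsFractionRing.injective _ _
  have hq : qK ≠ 0 := (map_ne_zero_iff _ hinj).2 (X_ne_zero 0)
  have hz : zK ≠ 0 := (map_ne_zero_iff _ hinj).2 (X_ne_zero 1)
  have hpow (n : ℕ) (hn : n ≠ 0) : qK ^ n ≠ 1 := by
    intro h
    rw [qK, ← map_pow, ← map_one (algebraMap (MvPolynomial (Fin 2) ℚ) K)] at h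
    simpa [hn] using congrArg (eval fun _ => (0 : ℚ)) (hinj h)
  have hmul (n : ℕ) : qK ^ n * zK ≠ 1 := by
    intro h
    rw [qK, zK, ← map_pow, ← map_mul, ← map_one (algebraMap (MvPolynomial (Fin 2) ℚ) K)] at h
    simpa using congrArg (eval fun _ => (0 : ℚ)) (hinj h)
  have hne (n : ℕ) : zK ≠ qK ^ n := by
    intro h
    rw [qK, zK, ← map_pow] at h
    simpa using congrArg (eval ![(1 : ℚ), 0]) (hinj h)
  refine ⟨hq, hz, fun i hi h => ?_, fun i h => ?_⟩
  · obtain ⟨n, rfl | rfl⟩ := i.eq_nat_or_neg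
    · exact hpow n (by omega) (by simpa using h)
    · exact hpow n (by omega) (by simpa using h)
  · obtain ⟨n, rfl | rfl⟩ := i.eq_nat_or_neg
    · exact hmul n (by simpa using h)
    · refine hne n ?_
      rwa [zpow_neg, zpow_natCast, inv_mul_eq_one₀ (pow_ne_zero n hq), eq_comm] at h

lemma evenSum_qK_zK (N : ℕ) (k l r : ℤ) : evenSum qK zK N k l r = dE N k l r := by
  rw [evenSum, vertexSum, dE, Finset.sum_filter, Finset.sum_product]
  refine Finset.sum_congr rfl fun m _ => Finset.sum_congr rfl fun n _ => ?_
  rw [show vertexTerm qK zK N k l r m n = dmn N k l r m n from rfl]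
  by_cases hlt : m + n < N
  · simp [hlt]
  · by_cases heq : m + n = N <;> by_cases hm : Even m <;> simp [hlt, heq, hm]

lemma latticeSum_qK_zK {N : ℕ} (hN : N ≠ 0) (k l r : ℤ) :
    latticeSum qK zK N k l r = pPoly N k l r := by
  have hset : extendedASet N k l r = ASet N k l r := by
    ext a
    simp [extendedASet, hN]
  rw [latticeSum, hset]
  rfl

theorem lattice_gen_poly_eq_dE_even (N : ℕ) (hN : 2 ≤ N) (hNeven : Even N)
    (k l r : ℤ) (hk : 1 ≤ k) (hl0 : 0 ≤ l) (hlk : l ≤ k) (hr0 : 0 ≤ r) (hrk : r ≤ k)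
    (hlr : k ≤ l + r) :
    pPoly N k l r = dE N k l r := by
  have hwall : wall N k r ≤ l := by
    rw [wall, if_pos hNeven]
    omega
  rw [← latticeSum_qK_zK (by omega), ← evenSum_qK_zK]
  exact (latticeSum_eq_oddSum_and_evenSum N isGenericPair_qK_zK hl0 hlk hr0 hrk).2 hwall

end
end

section
/- Let N ≥ 3 and let k, l, r be arbitrary integers. Then in ℚ(q,z): d^e_N(k,l,r;q,z) = d^e_N(k,l,r−1;q,z) + (q^N z)^r · d^e_{N−1}(k,l,k−r;q,z), and likewise d^o_N(k,l,r;q,z) = d^o_N(k,l,r−1;q,z) + (q^N z)^r · d^o_{N−1}(k,l,k−r;q,z), where (q^N z)^r is taken in the fraction field (r may be negative). -/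
/-!
STATEMENT 11: For N ≥ 3 and arbitrary integers k, l, r, in ℚ(q,z):
d^e_N(k,l,r) = d^e_N(k,l,r-1) + (q^N z)^r d^e_{N-1}(k,l,k-r), and likewise for d^o.
-/

open MvPolynomial

noncomputable section

/-- Raising `r` by one multiplies the monomial of `M_{m,n}` by `q ^ shiftQ N n * z ^ (n % 2)`. -/
def shiftQ (N n : ℕ) : ℤ := if Even n then (n / 2 : ℕ) else N - (n / 2 : ℕ)

/-- The denominator of `dmn N k l r m n`. -/
def dmnDen (N m n : ℕ) : K :=
  (∏ i ∈ Finset.Icc 1 (m / 2), (1 - qK ^ (i : ℤ))) *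
    (∏ i ∈ Finset.Icc (m / 2 + 1) m, (1 - qK ^ (-(i : ℤ)) * zK⁻¹)) *
    (∏ i ∈ Finset.Icc (m + 1) (N - n), (1 - qK ^ (i : ℤ) * zK)) *
    (∏ i ∈ Finset.Icc 1 (n / 2), (1 - qK ^ (-(i : ℤ)))) *
    (∏ i ∈ Finset.Icc (n / 2 + 1) n, (1 - qK ^ ((i : ℤ) - N - 1) * zK⁻¹))

lemma qK_ne_zero : qK ≠ 0 := by
  simp [qK, X_ne_zero]

lemma zK_ne_zero : zK ≠ 0 := by
  simp [zK, X_ne_zero]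

lemma qK_pow_ne_one {a : ℕ} (ha : a ≠ 0) : qK ^ a ≠ 1 := by
  intro h
  rw [qK, ← map_pow, ← map_one (algebraMap (MvPolynomial (Fin 2) ℚ) K)] at h
  have h' := congrArg (eval 0) (IsFractionRing.injective (MvPolynomial (Fin 2) ℚ) K h)
  simp [ha] at h'

lemma qK_pow_mul_zK_ne_one (a : ℕ) : qK ^ a * zK ≠ 1 := by
  intro h
  rw [qK, zK, ← map_pow, ← map_mul, ← map_one (algebraMap (MvPolynomial (Fin 2) ℚ) K)] at h
  have h' := congrArg (eval 0) (IsFractionRing.injective (MvPolynomial (Fin 2) ℚ) K h)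
  simp at h'

lemma one_sub_shift_ne_zero {N n : ℕ} (hn : n ≤ N) (hn0 : n ≠ 0) :
    1 - qK ^ (-shiftQ N n) * zK ^ (-((n % 2 : ℕ) : ℤ)) ≠ 0 := by
  rw [sub_ne_zero, zpow_neg, zpow_neg, ← mul_inv, ne_comm, ne_eq, inv_eq_one]
  unfold shiftQ
  split_ifs with h
  · rw [Nat.even_iff.1 h, zpow_natCast]
    simpa using qK_pow_ne_one (a := n / 2) (by grind)
  · rw [Nat.not_even_iff.1 h, ← Nat.cast_sub (by omega), zpow_natCast]
    simpa using qK_pow_mul_zK_ne_one (N - n / 2)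

lemma Mvec_succ_last (M : ℕ) (k l r : ℤ) {m n : ℕ} (h : m + n ≤ M) :
    Mvec (M + 1) k l r m (n + 1) (Fin.last M) = r := by
  have h₁ : ¬ M + 1 ≤ m := by omega
  have h₂ : M + 1 - (n + 1) < M + 1 := by omega
  simp [Mvec, h₁]

lemma Mvec_succ_castSucc (M : ℕ) (k l r : ℤ) (m n : ℕ) (j : Fin M) :
    Mvec (M + 1) k l r m (n + 1) j.castSucc = Mvec M k l (k - r) m n j := by
  have hj := j.2
  simp only [Mvec, Fin.val_castSucc, Nat.add_sub_add_right, sub_sub_cancel]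
  split_ifs <;> first | rfl | omega

lemma phiQ_Mvec_succ (M : ℕ) (k l r : ℤ) {m n : ℕ} (h : m + n ≤ M) :
    phiQ (M + 1) (Mvec (M + 1) k l r m (n + 1)) =
      (M + 1) * r + phiQ M (Mvec M k l (k - r) m n) := by
  simp [phiQ, Fin.sum_univ_castSucc, Mvec_succ_last M k l r h, Mvec_succ_castSucc, add_comm]

lemma phiZ_Mvec_succ (M : ℕ) (k l r : ℤ) {m n : ℕ} (h : m + n ≤ M) :
    phiZ (M + 1) (Mvec (M + 1) k l r m (n + 1)) = r + phiZ M (Mvec M k l (k - r) m n) := by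
  simp [phiZ, Fin.sum_univ_castSucc, Mvec_succ_last M k l r h, Mvec_succ_castSucc, add_comm]

lemma shiftQ_succ_succ (M n : ℕ) : shiftQ (M + 1) (n + 1) = M + 1 - shiftQ M n := by
  unfold shiftQ
  split_ifs <;> grind

lemma phiQ_Mvec_sub_one (N : ℕ) (k l r : ℤ) {m n : ℕ} (h : m + n ≤ N) :
    phiQ N (Mvec N k l (r - 1) m n) = phiQ N (Mvec N k l r m n) - shiftQ N n := by
  induction n generalizing N r with
  | zero => simp [Mvec_zero_right N k l (r - 1) r, shiftQ]
  | succ n ih =>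
    obtain ⟨M, rfl⟩ : ∃ M, N = M + 1 := ⟨N - 1, by omega⟩
    have ih' := ih M (k - (r - 1)) (by omega)
    rw [show k - (r - 1) - 1 = k - r by ring] at ih'
    rw [phiQ_Mvec_succ M k l _ (by omega), phiQ_Mvec_succ M k l _ (by omega), shiftQ_succ_succ, ih']
    ring

lemma phiZ_Mvec_sub_one (N : ℕ) (k l r : ℤ) {m n : ℕ} (h : m + n ≤ N) :
    phiZ N (Mvec N k l (r - 1) m n) = phiZ N (Mvec N k l r m n) - (n % 2 : ℕ) := by
  induction n generalizing N r with
  | zero => simp [Mvec_zero_right N k l (r - 1) r]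
  | succ n ih =>
    obtain ⟨M, rfl⟩ : ∃ M, N = M + 1 := ⟨N - 1, by omega⟩
    have ih' := ih M (k - (r - 1)) (by omega)
    rw [show k - (r - 1) - 1 = k - r by ring] at ih'
    rw [phiZ_Mvec_succ M k l _ (by omega), phiZ_Mvec_succ M k l _ (by omega), ih']
    omega

lemma dmnDen_succ (M m n : ℕ) :
    dmnDen (M + 1) m (n + 1) =
      dmnDen M m n * (1 - qK ^ (-shiftQ (M + 1) (n + 1)) * zK ^ (-(((n + 1) % 2 : ℕ) : ℤ))) := by
  have hshift (a b : ℕ) :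
      ∏ i ∈ Finset.Icc (a + 1) (b + 1), (1 - qK ^ ((i : ℤ) - (M + 1 : ℕ) - 1) * zK⁻¹) =
        ∏ i ∈ Finset.Icc a b, (1 - qK ^ ((i : ℤ) - M - 1) * zK⁻¹) := by
    rw [← Finset.map_add_right_Icc, Finset.prod_map]
    refine Finset.prod_congr rfl fun i _ => ?_
    congr 3
    simp
  unfold dmnDen
  rw [Nat.add_sub_add_right, hshift]
  obtain ⟨a, rfl | rfl⟩ := Nat.even_or_odd' n
  · rw [show (2 * a + 1) / 2 = a by omega, show (2 * a + 1) % 2 = 1 by omega,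
      show 2 * a / 2 = a by omega]
    have hs : -shiftQ (M + 1) (2 * a + 1) = (a : ℤ) - M - 1 := by
      rw [shiftQ_succ_succ]
      simp [shiftQ]
      ring
    rw [hs, Nat.cast_one, zpow_neg_one]
    rcases Nat.eq_zero_or_pos a with rfl | ha
    · simp
    · rw [← Finset.mul_prod_Ioc_eq_prod_Icc (a := a) (by omega), ← Finset.Icc_add_one_left_eq_Ioc]
      ring
  · rw [show (2 * a + 1 + 1) / 2 = a + 1 by omega, show (2 * a + 1 + 1) % 2 = 0 by omega,
      show (2 * a + 1) / 2 = a by omega]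
    have hs : -shiftQ (M + 1) (2 * a + 1 + 1) = -((a + 1 : ℕ) : ℤ) := by
      rw [shiftQ, if_pos (by grind), show (2 * a + 1 + 1) / 2 = a + 1 by omega]
    rw [hs, Finset.prod_Icc_succ_top (by omega)]
    simp only [Nat.cast_zero, neg_zero, zpow_zero, mul_one]
    ring

lemma dmn_eq (N : ℕ) (k l r : ℤ) (m n : ℕ) :
    dmn N k l r m n =
      qK ^ phiQ N (Mvec N k l r m n) * zK ^ phiZ N (Mvec N k l r m n) / dmnDen N m n := rfl

lemma dmn_zero_right (N : ℕ) (k l r r' : ℤ) (m : ℕ) : dmn N k l r m 0 = dmn N k l r' m 0 := by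
  rw [dmn_eq, dmn_eq, Mvec_zero_right N k l r r']

lemma dmn_succ (M : ℕ) (k l r : ℤ) {m n : ℕ} (h : m + n ≤ M) :
    dmn (M + 1) k l r m (n + 1) =
      dmn (M + 1) k l (r - 1) m (n + 1) + (qK ^ (M + 1) * zK) ^ r * dmn M k l (k - r) m n := by
  have hmono : (qK ^ (M + 1) * zK) ^ r *
      (qK ^ phiQ M (Mvec M k l (k - r) m n) * zK ^ phiZ M (Mvec M k l (k - r) m n)) =
      qK ^ phiQ (M + 1) (Mvec (M + 1) k l r m (n + 1)) *
        zK ^ phiZ (M + 1) (Mvec (M + 1) k l r m (n + 1)) := by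
    rw [phiQ_Mvec_succ M k l r h, phiZ_Mvec_succ M k l r h, zpow_add₀ qK_ne_zero,
      zpow_add₀ zK_ne_zero, mul_zpow, ← zpow_natCast, ← zpow_mul]
    push_cast
    ring
  have hf := one_sub_shift_ne_zero (N := M + 1) (n := n + 1) (by omega) (by omega)
  simp only [dmn_eq]
  rw [← mul_div_assoc, hmono, phiQ_Mvec_sub_one (M + 1) k l r (by omega),
    phiZ_Mvec_sub_one (M + 1) k l r (by omega), sub_eq_add_neg (phiQ _ _),
    sub_eq_add_neg (phiZ _ _), zpow_add₀ qK_ne_zero, zpow_add₀ zK_ne_zero, dmnDen_succ,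
    ← mul_div_mul_right _ (dmnDen M m n) hf, ← add_div]
  ring

lemma sum_dmn_succ (P : ℕ → Prop) [DecidablePred P] (M : ℕ) (k l r : ℤ) :
    ∑ p ∈ (Finset.range (M + 1 + 1) ×ˢ Finset.range (M + 1 + 1)).filter
        (fun p => p.1 + p.2 < M + 1 ∨ (p.1 + p.2 = M + 1 ∧ P p.1)),
      dmn (M + 1) k l r p.1 p.2 =
    ∑ p ∈ (Finset.range (M + 1 + 1) ×ˢ Finset.range (M + 1 + 1)).filter
        (fun p => p.1 + p.2 < M + 1 ∨ (p.1 + p.2 = M + 1 ∧ P p.1)),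
      dmn (M + 1) k l (r - 1) p.1 p.2 +
    (qK ^ (M + 1) * zK) ^ r *
      ∑ p ∈ (Finset.range (M + 1) ×ˢ Finset.range (M + 1)).filter
          (fun p => p.1 + p.2 < M ∨ (p.1 + p.2 = M ∧ P p.1)),
        dmn M k l (k - r) p.1 p.2 := by
  have hextend :
      ∑ p ∈ (Finset.range (M + 1) ×ˢ Finset.range (M + 1)).filter
          (fun p => p.1 + p.2 < M ∨ (p.1 + p.2 = M ∧ P p.1)), dmn M k l (k - r) p.1 p.2 =
      ∑ p ∈ (Finset.range (M + 1 + 1) ×ˢ Finset.range (M + 1)).filter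
          (fun p => p.1 + p.2 < M ∨ (p.1 + p.2 = M ∧ P p.1)), dmn M k l (k - r) p.1 p.2 := by
    refine Finset.sum_congr (Finset.ext fun p => ?_) fun _ _ => rfl
    simp only [Finset.mem_filter, Finset.mem_product, Finset.mem_range]
    grind
  rw [hextend]
  simp only [Finset.sum_filter, Finset.sum_product, Finset.mul_sum]
  rw [← Finset.sum_add_distrib]
  refine Finset.sum_congr rfl fun m _ => ?_
  rw [Finset.sum_range_succ', Finset.sum_range_succ' _ (M + 1), dmn_zero_right _ k l r (r - 1),
    add_right_comm, ← Finset.sum_add_distrib]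
  congr 1
  refine Finset.sum_congr rfl fun n _ => ?_
  have hiff : (m + (n + 1) < M + 1 ∨ m + (n + 1) = M + 1 ∧ P m) ↔
      (m + n < M ∨ m + n = M ∧ P m) := by
    rw [← add_assoc, add_lt_add_iff_right, add_left_inj]
  simp only [hiff]
  split_ifs with hc
  · exact dmn_succ M k l r (by omega)
  · simp

theorem dE_dO_recursion (N : ℕ) (hN : 3 ≤ N) (k l r : ℤ) :
    dE N k l r = dE N k l (r - 1) + (qK ^ N * zK) ^ r * dE (N - 1) k l (k - r) ∧
    dO N k l r = dO N k l (r - 1) + (qK ^ N * zK) ^ r * dO (N - 1) k l (k - r) := by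
  obtain ⟨M, rfl⟩ : ∃ M, N = M + 1 := ⟨N - 1, by omega⟩
  exact ⟨sum_dmn_succ Even M k l r, sum_dmn_succ Odd M k l r⟩

end
end

section
/- Let k, l be arbitrary integers. If N ≥ 3 is odd then d^e_N(k,l,−1;q,z) = 0 in ℚ(q,z); if N ≥ 2 is even then d^o_N(k,l,−1;q,z) = 0 in ℚ(q,z). -/
/-!
STATEMENT 12: If N ≥ 3 is odd then d^e_N(k,l,-1;q,z) = 0; if N ≥ 2 is even then
d^o_N(k,l,-1;q,z) = 0 (identities in ℚ(q,z), for arbitrary integers k, l).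
-/

open MvPolynomial

noncomputable section

/-- Passing from `M_{m,2p}` to `M_{m,2p+1}` only changes the coordinate `N - 2p`, from `0` to `r`. -/
lemma Mvec_two_mul_add_one (N : ℕ) (k l r : ℤ) (m p : ℕ) (h : m + (2 * p + 1) ≤ N) (j : Fin N) :
    Mvec N k l r m (2 * p + 1) j =
      Mvec N k l r m (2 * p) j + if j = ⟨N - 2 * p - 1, by omega⟩ then r else 0 := by
  have hj := j.2
  simp only [Mvec, Fin.ext_iff]
  split_ifs <;> omega

lemma phiQ_Mvec_two_mul_add_one (N : ℕ) (k l r : ℤ) (m p : ℕ) (h : m + (2 * p + 1) ≤ N) :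
    phiQ N (Mvec N k l r m (2 * p + 1)) =
      phiQ N (Mvec N k l r m (2 * p)) + (N - 2 * p : ℤ) * r := by
  simp only [phiQ, Mvec_two_mul_add_one N k l r m p h, mul_add, Finset.sum_add_distrib, mul_ite,
    mul_zero, Finset.sum_ite_eq', Finset.mem_univ, if_true]
  congr 2
  omega

lemma phiZ_Mvec_two_mul_add_one (N : ℕ) (k l r : ℤ) (m p : ℕ) (h : m + (2 * p + 1) ≤ N) :
    phiZ N (Mvec N k l r m (2 * p + 1)) = phiZ N (Mvec N k l r m (2 * p)) + r := by
  simp [phiZ, Mvec_two_mul_add_one N k l r m p h, Finset.sum_add_distrib]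

/-- At `r = -1` the contributions of `M_{m,2p}` and `M_{m,2p+1}` cancel. -/
lemma dmn_two_mul_add_one (N : ℕ) (k l : ℤ) (m p : ℕ) (h : m + (2 * p + 1) ≤ N) :
    dmn N k l (-1) m (2 * p + 1) = -dmn N k l (-1) m (2 * p) := by
  obtain ⟨c, rfl⟩ : ∃ c, N = c + (2 * p + 1) := ⟨N - (2 * p + 1), by omega⟩
  have hq := qK_ne_zero
  have hz := zK_ne_zero
  rw [dmn, dmn, phiQ_Mvec_two_mul_add_one _ _ _ _ _ _ h, phiZ_Mvec_two_mul_add_one _ _ _ _ _ _ h,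
    show (2 * p + 1) / 2 = p by omega, show 2 * p / 2 = p by omega,
    show c + (2 * p + 1) - (2 * p + 1) = c by omega, show c + (2 * p + 1) - 2 * p = c + 1 by omega,
    Finset.prod_Icc_succ_top (show m + 1 ≤ c + 1 by omega),
    Finset.prod_Icc_succ_top (show p + 1 ≤ 2 * p + 1 by omega)]
  set u : K := qK ^ ((c + 1 : ℕ) : ℤ) * zK with hu
  have hu0 : u ≠ 0 := mul_ne_zero (zpow_ne_zero _ hq) hz
  have hfactor : 1 - qK ^ (((2 * p + 1 : ℕ) : ℤ) - (c + (2 * p + 1) : ℕ) - 1) * zK⁻¹ =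
      -u⁻¹ * (1 - u) := by
    have hexp : ((2 * p + 1 : ℕ) : ℤ) - (c + (2 * p + 1) : ℕ) - 1 = -((c + 1 : ℕ) : ℤ) := by
      push_cast; ring
    rw [hexp, zpow_neg, ← mul_inv, ← hu]
    field_simp
    ring
  have hnum (a b : ℤ) : qK ^ (a + (((c + (2 * p + 1) : ℕ) : ℤ) - 2 * p) * -1) * zK ^ (b + -1) =
      qK ^ a * zK ^ b * u⁻¹ := by
    have hexp : a + (((c + (2 * p + 1) : ℕ) : ℤ) - 2 * p) * -1 = a + -((c + 1 : ℕ) : ℤ) := by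
      push_cast; ring
    rw [hexp, zpow_add₀ hq, zpow_add₀ hz, zpow_neg, zpow_neg_one, hu, mul_inv]
    ring
  rw [hfactor, hnum]
  simp only [div_eq_mul_inv, mul_inv, inv_neg, inv_inv]
  field_simp

/-- If `S` is stable under exchanging `(m, 2p)` and `(m, 2p+1)`, its contributions at `r = -1`
cancel in pairs. -/
lemma sum_dmn_eq_zero (N : ℕ) (k l : ℤ) (S : Finset (ℕ × ℕ)) (hle : ∀ x ∈ S, x.1 + x.2 ≤ N)
    (hS : ∀ m p, (m, 2 * p) ∈ S ↔ (m, 2 * p + 1) ∈ S) :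
    ∑ x ∈ S, dmn N k l (-1) x.1 x.2 = 0 := by
  refine Finset.sum_involution
    (fun x _ => (x.1, if x.2 % 2 = 0 then x.2 + 1 else x.2 - 1)) ?_ ?_ ?_ ?_
  all_goals
    rintro ⟨m, n⟩ hx
    obtain ⟨p, rfl | rfl⟩ := Nat.even_or_odd' n
  · have := dmn_two_mul_add_one N k l m p (hle _ ((hS m p).1 hx))
    simp [this]
  · have := dmn_two_mul_add_one N k l m p (hle _ hx)
    simp [this, Nat.add_mod]
  · simp
  · simp [Nat.add_mod]
  · simpa using (hS m p).1 hx
  · simpa [Nat.add_mod] using (hS m p).2 hx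
  · simp [Nat.add_mod]
  · simp [Nat.add_mod]

theorem dE_dO_vanish_at_r_neg_one (N : ℕ) (k l : ℤ) :
    (3 ≤ N → Odd N → dE N k l (-1) = 0) ∧
    (2 ≤ N → Even N → dO N k l (-1) = 0) := by
  constructor
  all_goals
    intro _ hN
    refine sum_dmn_eq_zero N k l _ ?_ ?_
    · simp only [Finset.mem_filter]
      omega
    · intro m p
      simp only [Finset.mem_filter, Finset.mem_product, Finset.mem_range, Nat.odd_iff,
        Nat.even_iff] at hN ⊢
      omega

end
end

section
/- Let N ≥ 1 and let k, l, r be integers with l + r = k. Then d^e_{2N}(k,l,r;q,z) = d^o_{2N}(k,l,r;q,z) in ℚ(q,z). -/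
/-!
STATEMENT 13: For N ≥ 1 and integers k, l, r with l + r = k,
d^e_{2N}(k,l,r;q,z) = d^o_{2N}(k,l,r;q,z) in ℚ(q,z).
-/

open MvPolynomial

noncomputable section

lemma qK_pow_mul_zK_pow_ne_one {i j : ℕ} (h : i ≠ 0 ∨ j ≠ 0) : qK ^ i * zK ^ j ≠ 1 := by
  intro e
  have e' : algebraMap (MvPolynomial (Fin 2) ℚ) K (X 0 ^ i * X 1 ^ j) =
      algebraMap (MvPolynomial (Fin 2) ℚ) K 1 := by
    simpa [qK, zK] using e
  have := congrArg (MvPolynomial.eval fun _ => (0 : ℚ))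
    (IsFractionRing.injective (MvPolynomial (Fin 2) ℚ) K e')
  rcases h with h | h <;> simp [h] at this

lemma one_sub_qK_pow_ne_zero {i : ℕ} (h : i ≠ 0) : 1 - qK ^ (i : ℤ) ≠ 0 := by
  rw [sub_ne_zero, ne_comm, zpow_natCast]
  simpa using qK_pow_mul_zK_pow_ne_one (j := 0) (.inl h)

lemma one_sub_qK_neg_pow_ne_zero {i : ℕ} (h : i ≠ 0) : 1 - qK ^ (-(i : ℤ)) ≠ 0 := by
  rw [sub_ne_zero, ne_comm, zpow_neg, ne_eq, inv_eq_one, ← ne_eq, ne_comm, ← sub_ne_zero]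
  exact one_sub_qK_pow_ne_zero h

lemma one_sub_qK_zK_inv_ne_zero (i : ℕ) : 1 - qK ^ (-(i : ℤ)) * zK⁻¹ ≠ 0 := by
  rw [sub_ne_zero, ne_comm, zpow_neg, ← mul_inv, ne_eq, inv_eq_one, zpow_natCast]
  simpa using qK_pow_mul_zK_pow_ne_one (i := i) (j := 1) (.inr one_ne_zero)

/-- When `l + r = k`, all vertices `M_{m,n}` with `m + n = 2N` coincide. -/
lemma Mvec_of_add_eq {N m n : ℕ} {k l r : ℤ} (h : l + r = k) (hmn : m + n = 2 * N) :
    Mvec (2 * N) k l r m n = fun j => if j.1 % 2 = 0 then l else r := by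
  funext j
  have := j.2
  unfold Mvec
  split_ifs <;> omega

/-- The denominator of `d^{m,n}_{2N}` on the boundary `m + n = 2N`. -/
def boundaryDenom (m n : ℕ) : K :=
  (∏ i ∈ Finset.Icc 1 (m / 2), (1 - qK ^ (i : ℤ))) *
    (∏ i ∈ Finset.Icc 1 (n / 2), (1 - qK ^ (-(i : ℤ)))) *
    ∏ i ∈ Finset.Ioc (m / 2) (m + n - n / 2), (1 - qK ^ (-(i : ℤ)) * zK⁻¹)

lemma dmn_of_add_eq {N m n : ℕ} {k l r : ℤ} (h : l + r = k) (hmn : m + n = 2 * N) :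
    dmn (2 * N) k l r m n =
      qK ^ phiQ (2 * N) (fun j => if j.1 % 2 = 0 then l else r) *
        zK ^ phiZ (2 * N) (fun j => if j.1 % 2 = 0 then l else r) / boundaryDenom m n := by
  have hempty : Finset.Icc (m + 1) (2 * N - n) = ∅ := Finset.Icc_eq_empty (by omega)
  have hreflect : ∏ i ∈ Finset.Icc (n / 2 + 1) n,
      (1 - qK ^ ((i : ℤ) - (2 * N : ℕ) - 1) * zK⁻¹) =
      ∏ i ∈ Finset.Ioc m (m + n - n / 2), (1 - qK ^ (-(i : ℤ)) * zK⁻¹) := by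
    refine Finset.prod_nbij' (fun i => 2 * N + 1 - i) (fun i => 2 * N + 1 - i) ?_ ?_ ?_ ?_ ?_ <;>
      intro i hi <;> simp only [Finset.mem_Icc, Finset.mem_Ioc] at hi ⊢
    iterate 4 omega
    congr 3
    omega
  rw [dmn, Mvec_of_add_eq h hmn, hempty, hreflect, Finset.Icc_add_one_left_eq_Ioc, boundaryDenom,
    ← Finset.prod_Ioc_consecutive _ (Nat.div_le_self m 2) (show m ≤ m + n - n / 2 by omega)]
  congr 1
  rw [Finset.prod_empty]
  ring

lemma boundaryDenom_ne_zero (m n : ℕ) : boundaryDenom m n ≠ 0 := by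
  refine mul_ne_zero (mul_ne_zero ?_ ?_) ?_ <;> rw [Finset.prod_ne_zero_iff] <;> intro i hi
  · exact one_sub_qK_pow_ne_zero (by simp at hi; omega)
  · exact one_sub_qK_neg_pow_ne_zero (by simp at hi; omega)
  · exact one_sub_qK_zK_inv_ne_zero i

lemma boundaryDenom_odd_eq_left (a b : ℕ) :
    boundaryDenom (2 * a + 1) (2 * b + 1) * (1 - qK ^ (-((b : ℤ) + 1))) =
      boundaryDenom (2 * a) (2 * (b + 1)) * (1 - qK ^ (-(2 * a + b + 2 : ℤ)) * zK⁻¹) := by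
  simp only [boundaryDenom]
  rw [show (2 * a + 1) / 2 = a by omega, show (2 * b + 1) / 2 = b by omega,
    show 2 * a / 2 = a by omega, show 2 * (b + 1) / 2 = b + 1 by omega,
    show 2 * a + 1 + (2 * b + 1) - b = 2 * a + b + 1 + 1 by omega,
    show 2 * a + 2 * (b + 1) - (b + 1) = 2 * a + b + 1 by omega,
    Finset.prod_Ioc_succ_top (by omega), Finset.prod_Icc_succ_top (by omega)]
  push_cast
  rw [show (2 * a + b + 1 + 1 : ℤ) = 2 * a + b + 2 by ring]
  ring

lemma boundaryDenom_odd_eq_right (a b : ℕ) :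
    boundaryDenom (2 * a + 1) (2 * b + 1) * (1 - qK ^ ((a : ℤ) + 1)) =
      boundaryDenom (2 * (a + 1)) (2 * b) * (1 - qK ^ (-((a : ℤ) + 1)) * zK⁻¹) := by
  simp only [boundaryDenom]
  rw [show (2 * a + 1) / 2 = a by omega, show (2 * b + 1) / 2 = b by omega,
    show 2 * b / 2 = b by omega, show 2 * (a + 1) / 2 = a + 1 by omega,
    show 2 * a + 1 + (2 * b + 1) - b = 2 * a + b + 2 by omega,
    show 2 * (a + 1) + 2 * b - b = 2 * a + b + 2 by omega,
    ← Finset.prod_Ioc_consecutive _ (Nat.le_succ a) (show a + 1 ≤ 2 * a + b + 2 by omega),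
    Nat.Ioc_succ_singleton, Finset.prod_singleton, Finset.prod_Icc_succ_top (by omega)]
  push_cast
  ring

/-- Each odd boundary term is a combination of its two even neighbours. -/
lemma one_sub_div_boundaryDenom_odd (a b : ℕ) :
    (1 - qK ^ (a + b + 1)) / boundaryDenom (2 * a + 1) (2 * b + 1) =
      (1 - qK ^ (a + 1)) / boundaryDenom (2 * (a + 1)) (2 * b) +
        (qK ^ a - qK ^ (a + b + 1)) / boundaryDenom (2 * a) (2 * (b + 1)) := by
  have hl := boundaryDenom_odd_eq_left a b
  have hr := boundaryDenom_odd_eq_right a b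
  have h0 := boundaryDenom_ne_zero (2 * a + 1) (2 * b + 1)
  have h1 := boundaryDenom_ne_zero (2 * (a + 1)) (2 * b)
  have h2 := boundaryDenom_ne_zero (2 * a) (2 * (b + 1))
  have hq := qK_ne_zero
  have e1 : (1 - qK ^ (a + 1)) / boundaryDenom (2 * (a + 1)) (2 * b) =
      (1 - qK ^ (-((a : ℤ) + 1)) * zK⁻¹) / boundaryDenom (2 * a + 1) (2 * b + 1) := by
    rw [div_eq_div_iff h1 h0, ← zpow_natCast]
    push_cast
    linear_combination hr
  have e2 : (qK ^ a - qK ^ (a + b + 1)) / boundaryDenom (2 * a) (2 * (b + 1)) =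
      -qK ^ (a + b + 1) * (1 - qK ^ (-(2 * a + b + 2 : ℤ)) * zK⁻¹) /
        boundaryDenom (2 * a + 1) (2 * b + 1) := by
    have : qK ^ a = qK ^ (a + b + 1) * qK ^ (-((b : ℤ) + 1)) := by
      rw [← zpow_natCast, ← zpow_natCast, ← zpow_add₀ hq]
      congr 1
      push_cast
      ring
    rw [div_eq_div_iff h2 h0, this]
    linear_combination -qK ^ (a + b + 1) * hl
  have e3 : qK ^ (-((a : ℤ) + 1)) = qK ^ (a + b + 1) * qK ^ (-(2 * a + b + 2 : ℤ)) := by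
    rw [← zpow_natCast, ← zpow_add₀ hq]
    congr 1
    push_cast
    ring
  rw [e1, e2, ← add_div, e3]
  congr 1
  ring

lemma sum_inv_boundaryDenom_even_eq_odd {N : ℕ} (hN : N ≠ 0) :
    ∑ a ∈ Finset.range (N + 1), (boundaryDenom (2 * a) (2 * (N - a)))⁻¹ =
      ∑ a ∈ Finset.range N, (boundaryDenom (2 * a + 1) (2 * (N - 1 - a) + 1))⁻¹ := by
  have hq : 1 - qK ^ N ≠ 0 := by simpa using one_sub_qK_pow_ne_zero hN
  refine mul_left_cancel₀ hq ?_
  simp only [Finset.mul_sum, ← div_eq_mul_inv]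
  calc
    _ = ∑ a ∈ Finset.range (N + 1), (1 - qK ^ a) / boundaryDenom (2 * a) (2 * (N - a)) +
        ∑ a ∈ Finset.range (N + 1), (qK ^ a - qK ^ N) / boundaryDenom (2 * a) (2 * (N - a)) := by
      rw [← Finset.sum_add_distrib]
      refine Finset.sum_congr rfl fun a _ => ?_
      rw [← add_div, sub_add_sub_cancel]
    _ = _ := by
      rw [Finset.sum_range_succ', Finset.sum_range_succ (fun a => (qK ^ a - qK ^ N) / _)]
      simp only [pow_zero, sub_self, zero_div, add_zero]
      rw [← Finset.sum_add_distrib]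
      refine Finset.sum_congr rfl fun a ha => ?_
      obtain ⟨b, rfl⟩ := Nat.exists_eq_add_of_lt (Finset.mem_range.mp ha)
      rw [show a + b + 1 - 1 - a = b by omega, show a + b + 1 - (a + 1) = b by omega,
        show a + b + 1 - a = b + 1 by omega, one_sub_div_boundaryDenom_odd]

theorem dE_eq_dO_of_add_eq (N : ℕ) (hN : 1 ≤ N) (k l r : ℤ) (h : l + r = k) :
    dE (2 * N) k l r = dO (2 * N) k l r := by
  rw [dE, dO, Finset.filter_or, Finset.filter_or,
    Finset.sum_union (Finset.disjoint_filter.mpr fun p _ h₁ h₂ => h₁.ne h₂.1),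
    Finset.sum_union (Finset.disjoint_filter.mpr fun p _ h₁ h₂ => h₁.ne h₂.1)]
  congr 1
  set c := qK ^ phiQ (2 * N) (fun j => if j.1 % 2 = 0 then l else r) *
    zK ^ phiZ (2 * N) (fun j => if j.1 % 2 = 0 then l else r) with hc
  trans c * ∑ a ∈ Finset.range (N + 1), (boundaryDenom (2 * a) (2 * (N - a)))⁻¹
  · rw [Finset.mul_sum]
    refine Finset.sum_nbij' (fun p => p.1 / 2) (fun a => (2 * a, 2 * (N - a))) ?_ ?_ ?_ ?_ ?_
    · rintro ⟨m, n⟩ hp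
      simp [Nat.even_iff] at hp ⊢
      omega
    · intro a ha
      simp at ha ⊢
      omega
    · rintro ⟨m, n⟩ hp
      simp [Nat.even_iff] at hp ⊢
      omega
    · intro a ha
      simp
    · rintro ⟨m, n⟩ hp
      simp only [Finset.mem_filter, Nat.even_iff] at hp
      rw [dmn_of_add_eq h hp.2.1, ← hc, div_eq_mul_inv]
      congr 3 <;> omega
  · rw [sum_inv_boundaryDenom_even_eq_odd (by omega), Finset.mul_sum]
    symm
    refine Finset.sum_nbij' (fun p => p.1 / 2) (fun a => (2 * a + 1, 2 * (N - 1 - a) + 1))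
      ?_ ?_ ?_ ?_ ?_
    · rintro ⟨m, n⟩ hp
      simp [Nat.odd_iff] at hp ⊢
      omega
    · intro a ha
      simp at ha ⊢
      omega
    · rintro ⟨m, n⟩ hp
      simp [Nat.odd_iff] at hp ⊢
      omega
    · intro a ha
      simp
      omega
    · rintro ⟨m, n⟩ hp
      simp only [Finset.mem_filter, Nat.odd_iff] at hp
      rw [dmn_of_add_eq h hp.2.1, ← hc, div_eq_mul_inv]
      congr 3 <;> omega

end
end

section
/- Let N ≥ 2, k ≥ 1, l ≥ 0, r ≥ 0, m ≥ 0 be integers. Let S^m_N ⊆ ℂ[e_1,…,e_N] be the subspace of homogeneous polynomials of degree m, and for a linear functional φ on S^m_N define the polynomial P(φ)(t_1,…,t_m) = φ(e(t_1)⋯e(t_m)), where e(t) = ∑_{i=1}^N e_i t^i. Then: (a) P is a linear isomorphism from the dual space (S^m_N)* onto the space Σ^N_m of symmetric polynomials in t_1,…,t_m that are divisible by t_1⋯t_m and have degree at most N in each variable; (b) φ vanishes on I_N(k,l,r) ∩ S^m_N if and only if, writing P(φ) = t_1⋯t_m·f(t_1,…,t_m), the polynomial f satisfies: (1) if m ≥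 k+1, f(t_1,…,t_m) = 0 whenever t_1 = ⋯ = t_{k+1}; (2) if m ≥ l+1, f(t_1,…,t_m) = 0 whenever t_1 = ⋯ = t_{l+1} = 0; (3) if m ≥ r+1, the polynomial f(t,…,t,t_{r+2},…,t_m) (with the first r+1 variables set equal to t) has degree less than (r+1)(N−1) in t. Consequently P induces a linear isomorphism between the dual of the component of D_N(k,l,r) of z-degree m and the subspace Σ^N_m(k,l,r) of polynomials t_1⋯t_m·f ∈ Σ^N_m with f satisfying (1)–(3). -/
/-!
STATEMENT 19: the functional realization of the dual of the z-degree-m component of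
D_N(k,l,r).  The map P sends a linear functional φ on the space S^m_N of homogeneous
polynomials of degree m in e_1, …, e_N to the polynomial
P(φ)(t_1,…,t_m) = φ(e(t_1)⋯e(t_m)), where e(t) = ∑_{i=1}^N e_i t^i; expanding the
product, P(φ) = ∑_{α : Fin m → Fin N} φ(∏_j e_{α_j}) ∏_j t_j^{α_j}  (with
1-indexing, `e_i = X j` with `i = j.1+1`, and `t_s`, `s = j.1+1`, the variables of
`MvPolynomial (Fin m) ℂ`).

(a) P is a linear isomorphism from (S^m_N)* onto the space Σ^N_m of symmetric
polynomials divisible by t_1⋯t_m of degree at most N in each variable;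
(b) φ vanishes on I_N(k,l,r) ∩ S^m_N iff the polynomial f with
P(φ) = t_1⋯t_m·f satisfies conditions (1)–(3);
and consequently P restricts to a bijection from the annihilator of
I_N(k,l,r) ∩ S^m_N (i.e. the dual of the z-degree-m component of D_N(k,l,r))
onto the subspace Σ^N_m(k,l,r) of polynomials t_1⋯t_m·f ∈ Σ^N_m with f
satisfying (1)–(3).

Conditions on f (as ℂ is infinite, vanishing identities are stated via evaluation):
(1) if m ≥ k+1: f = 0 whenever t_1 = … = t_{k+1};
(2) if m ≥ l+1: f = 0 whenever t_1 = … = t_{l+1} = 0;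
(3) if m ≥ r+1: the polynomial f(t,…,t,t_{r+2},…,t_m) has degree < (r+1)(N-1) in t
    (realized by substituting the first variable t_1 for each of t_1, …, t_{r+1}).
-/

open MvPolynomial

noncomputable section

def genSet (N k l r : ℕ) : Set (MvPolynomial (Fin N) ℂ) :=
  {p | ∃ h : 0 < N, p = X (⟨0, h⟩ : Fin N) ^ (l + 1)} ∪
  {p | ∃ h : 0 < N, p = X (⟨N - 1, Nat.sub_lt h Nat.one_pos⟩ : Fin N) ^ (r + 1)} ∪
  {p | ∃ i : ℕ, k + 1 ≤ i ∧ i ≤ N * (k + 1) ∧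
      p = ∑ α ∈ Finset.univ.filter
            (fun α : Fin (k + 1) → Fin N => (∑ j, ((α j).1 + 1)) = i),
          ∏ j, X (α j)}

def IdealN (N k l r : ℕ) : Ideal (MvPolynomial (Fin N) ℂ) := Ideal.span (genSet N k l r)

/-- The map `P : (S^m_N)* → ℂ[t_1,…,t_m]`, `P(φ)(t_1,…,t_m) = φ(e(t_1)⋯e(t_m))`. -/
def Pfun (N m : ℕ) (φ : Module.Dual ℂ (homogeneousSubmodule (Fin N) ℂ m)) :
    MvPolynomial (Fin m) ℂ :=
  ∑ α : Fin m → Fin N,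
    φ ⟨∏ j, X (α j), by
        rw [mem_homogeneousSubmodule]
        simpa using MvPolynomial.IsHomogeneous.prod Finset.univ (fun j => X (α j))
          (fun _ => 1) (fun j _ => isHomogeneous_X ℂ (α j))⟩ •
      ∏ j : Fin m, (X j : MvPolynomial (Fin m) ℂ) ^ ((α j).1 + 1)

/-- Conditions (1)–(3) on the quotient `f` with `P(φ) = t_1⋯t_m·f`. -/
def Fconds (N k l r m : ℕ) (f : MvPolynomial (Fin m) ℂ) : Prop :=
  (k + 1 ≤ m → ∀ x : Fin m → ℂ,
      (∀ j j' : Fin m, j.1 ≤ k → j'.1 ≤ k → x j = x j') → eval x f = 0) ∧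
  (l + 1 ≤ m → ∀ x : Fin m → ℂ,
      (∀ j : Fin m, j.1 ≤ l → x j = 0) → eval x f = 0) ∧
  (∀ hrm : r + 1 ≤ m,
      degreeOf (⟨0, by omega⟩ : Fin m)
          (aeval (fun j : Fin m =>
              if j.1 ≤ r then (X ⟨0, by omega⟩ : MvPolynomial (Fin m) ℂ) else X j) f) <
        (r + 1) * (N - 1))

section Realization

variable {N m : ℕ}

/-- The monomial `e_{α_1} ⋯ e_{α_m}`. -/
def wordMonomial (α : Fin m → Fin N) : MvPolynomial (Fin N) ℂ := ∏ j, X (α j)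

/-- The exponent vector of `e_{α_1} ⋯ e_{α_m}`. -/
def wordExponent (α : Fin m → Fin N) : Fin N →₀ ℕ := ∑ j, Finsupp.single (α j) 1

/-- The exponent vector of `t_1 ^ (α_1 + 1) ⋯ t_m ^ (α_m + 1)`. -/
def shiftExponent (α : Fin m → Fin N) : Fin m →₀ ℕ :=
  Finsupp.equivFunOnFinite.symm fun j => (α j).1 + 1

lemma wordMonomial_eq (α : Fin m → Fin N) :
    wordMonomial α = monomial (wordExponent α) 1 := by
  rw [wordMonomial, wordExponent, monomial_sum_one]
  rfl

lemma wordMonomial_mem (α : Fin m → Fin N) :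
    wordMonomial α ∈ homogeneousSubmodule (Fin N) ℂ m := by
  rw [mem_homogeneousSubmodule]
  simpa [wordMonomial] using IsHomogeneous.prod Finset.univ (fun j => X (α j))
    (fun _ => 1) (fun j _ => isHomogeneous_X ℂ (α j))

lemma prod_X_pow_eq_monomial_equivFunOnFinite (g : Fin m → ℕ) :
    ∏ j, (X j : MvPolynomial (Fin m) ℂ) ^ g j =
      monomial (Finsupp.equivFunOnFinite.symm g) 1 := by
  rw [monomial_eq, Finsupp.prod_fintype _ _ (by simp)]
  simp

lemma shiftExponent_injective :
    Function.Injective (shiftExponent : (Fin m → Fin N) → Fin m →₀ ℕ) := by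
  intro α β h
  funext j
  have := DFunLike.congr_fun h j
  simp only [shiftExponent, Finsupp.equivFunOnFinite_symm_apply_apply] at this
  exact Fin.ext (by omega)

lemma exists_wordExponent_eq (q : ℕ) (s : Fin N →₀ ℕ) (hs : s.degree = q) :
    ∃ b : Fin q → Fin N, wordExponent b = s := by
  induction q generalizing s with
  | zero =>
    refine ⟨Fin.elim0, ?_⟩
    rw [Finsupp.degree_eq_zero_iff] at hs
    simp [wordExponent, hs]
  | succ q ih =>
    have hne : s ≠ 0 := by
      rintro rfl
      simp at hs
    obtain ⟨i, hi⟩ := Finsupp.ne_iff.mp hne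
    have hle : Finsupp.single i 1 ≤ s := by
      rw [Finsupp.single_le_iff]
      exact Nat.one_le_iff_ne_zero.mpr hi
    have hsub : s - Finsupp.single i 1 + Finsupp.single i 1 = s := tsub_add_cancel_of_le hle
    obtain ⟨b, hb⟩ := ih (s - Finsupp.single i 1) (by
      have := congrArg Finsupp.degree hsub
      rw [map_add, hs, Finsupp.degree_single] at this
      omega)
    refine ⟨Fin.cons i b, ?_⟩
    rw [wordExponent, Fin.sum_univ_succ]
    simp only [Fin.cons_zero, Fin.cons_succ]
    rw [← wordExponent, hb, add_comm, hsub]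

lemma exists_perm_of_wordExponent_eq {α β : Fin m → Fin N}
    (h : wordExponent α = wordExponent β) : ∃ σ : Equiv.Perm (Fin m), β ∘ σ = α := by
  have hcard : ∀ i, Nonempty ({j // α j = i} ≃ {j // β j = i}) := by
    intro i
    refine Fintype.card_eq.mp ?_
    have := DFunLike.congr_fun h i
    simpa [wordExponent, Finsupp.single_apply, Fintype.card_subtype] using this
  exact ⟨Equiv.ofFiberEquiv fun i => (hcard i).some,
    funext fun j => Equiv.ofFiberEquiv_map _ j⟩

variable (φ : Module.Dual ℂ (homogeneousSubmodule (Fin N) ℂ m))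

lemma Pfun_eq_sum_monomial : Pfun N m φ =
    ∑ α : Fin m → Fin N, monomial (shiftExponent α) (φ ⟨wordMonomial α, wordMonomial_mem α⟩) := by
  refine Finset.sum_congr rfl fun α _ => ?_
  rw [prod_X_pow_eq_monomial_equivFunOnFinite, smul_monomial]
  simp [shiftExponent, wordMonomial]

lemma coeff_Pfun (α : Fin m → Fin N) :
    coeff (shiftExponent α) (Pfun N m φ) = φ ⟨wordMonomial α, wordMonomial_mem α⟩ := by
  rw [Pfun_eq_sum_monomial, coeff_sum, Finset.sum_eq_single α]
  · simp
  · intro β _ hβ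
    rw [coeff_monomial, if_neg fun h => hβ (shiftExponent_injective h)]
  · simp

lemma exists_shiftExponent_eq_of_coeff_Pfun_ne_zero {s : Fin m →₀ ℕ}
    (hs : coeff s (Pfun N m φ) ≠ 0) : ∃ α : Fin m → Fin N, shiftExponent α = s := by
  by_contra! h
  refine hs ?_
  rw [Pfun_eq_sum_monomial, coeff_sum]
  exact Finset.sum_eq_zero fun α _ => by rw [coeff_monomial, if_neg (h α)]

lemma isLinearMap_Pfun : IsLinearMap ℂ (Pfun N m) where
  map_add φ ψ := by simp [Pfun, add_smul, Finset.sum_add_distrib]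
  map_smul c φ := by simp [Pfun, mul_smul, Finset.smul_sum]

lemma dual_ext {φ ψ : Module.Dual ℂ (homogeneousSubmodule (Fin N) ℂ m)}
    (h : ∀ α : Fin m → Fin N, φ ⟨wordMonomial α, wordMonomial_mem α⟩ =
      ψ ⟨wordMonomial α, wordMonomial_mem α⟩) : φ = ψ := by
  ext ⟨p, hp⟩
  have key : (⟨p, hp⟩ : homogeneousSubmodule (Fin N) ℂ m) ∈ Submodule.span ℂ
      (Set.range fun α : Fin m → Fin N =>
        (⟨wordMonomial α, wordMonomial_mem α⟩ : homogeneousSubmodule (Fin N) ℂ m)) := by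
    have hmap : p ∈ (Submodule.span ℂ (Set.range fun α : Fin m → Fin N =>
        (⟨wordMonomial α, wordMonomial_mem α⟩ : homogeneousSubmodule (Fin N) ℂ m))).map
        (homogeneousSubmodule (Fin N) ℂ m).subtype := by
      rw [Submodule.map_span, ← Set.range_comp, p.as_sum]
      refine Submodule.sum_mem _ fun s hs => ?_
      have hdeg : s.degree = m := by
        by_contra hne
        exact (mem_support_iff.mp hs) (((mem_homogeneousSubmodule _ _).mp hp).coeff_eq_zero hne)
      obtain ⟨α, rfl⟩ := exists_wordExponent_eq m s hdeg
      rw [← mul_one (coeff _ p), ← smul_eq_mul, ← smul_monomial, ← wordMonomial_eq]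
      exact Submodule.smul_mem _ _ (Submodule.subset_span ⟨α, rfl⟩)
    obtain ⟨x, hx, hxp⟩ := hmap
    have : x = ⟨p, hp⟩ := Subtype.ext hxp
    rwa [← this]
  refine LinearMap.eqOn_span ?_ key
  rintro _ ⟨α, rfl⟩
  exact h α

lemma Pfun_injective : Function.Injective (Pfun N m) := fun φ ψ h =>
  dual_ext fun α => by rw [← coeff_Pfun, ← coeff_Pfun, h]

lemma Pfun_isSymmetric : (Pfun N m φ).IsSymmetric := by
  intro σ
  simp only [Pfun, map_sum, map_smul, map_prod, map_pow, rename_X]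
  refine Fintype.sum_equiv (σ.arrowCongr (Equiv.refl _)) _ _ fun α => ?_
  congr 1
  · congr 2
    exact Fintype.prod_equiv σ _ _ fun j => by simp
  · exact Fintype.prod_equiv σ _ _ fun j => by simp

/-- The quotient `P(φ) / (t_1 ⋯ t_m)`. -/
def Pquot : MvPolynomial (Fin m) ℂ :=
  ∑ α : Fin m → Fin N, C (φ ⟨wordMonomial α, wordMonomial_mem α⟩) * ∏ j, X j ^ (α j).1

lemma Pfun_eq_prod_mul_Pquot : Pfun N m φ = (∏ j : Fin m, X j) * Pquot φ := by
  rw [Pfun, Pquot, Finset.mul_sum]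
  refine Finset.sum_congr rfl fun α _ => ?_
  rw [smul_eq_C_mul, mul_left_comm, ← Finset.prod_mul_distrib]
  simp only [pow_succ', wordMonomial]

lemma eq_Pquot_of_Pfun_eq {f : MvPolynomial (Fin m) ℂ}
    (h : Pfun N m φ = (∏ j : Fin m, X j) * f) : f = Pquot φ := by
  rw [Pfun_eq_prod_mul_Pquot] at h
  exact (mul_left_cancel₀ (Finset.prod_ne_zero_iff.mpr fun j _ => X_ne_zero j) h).symm

lemma coeff_shiftExponent_comp {p : MvPolynomial (Fin m) ℂ} (hp : p.IsSymmetric)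
    (α : Fin m → Fin N) (σ : Equiv.Perm (Fin m)) :
    coeff (shiftExponent (α ∘ σ)) p = coeff (shiftExponent α) p := by
  have hmap : Finsupp.mapDomain σ (shiftExponent (α ∘ σ)) = shiftExponent α := by
    ext j
    obtain ⟨i, rfl⟩ := σ.surjective j
    rw [Finsupp.mapDomain_apply σ.injective]
    rfl
  conv_rhs => rw [← hmap, ← hp σ]
  rw [coeff_rename_mapDomain _ σ.injective]

lemma exists_Pfun_eq {p : MvPolynomial (Fin m) ℂ} (hp : p.IsSymmetric)
    (hdvd : ∃ f, p = (∏ j : Fin m, X j) * f) (hdeg : ∀ j : Fin m, p.degreeOf j ≤ N) :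
    ∃ φ : Module.Dual ℂ (homogeneousSubmodule (Fin N) ℂ m), Pfun N m φ = p := by
  classical
  let φ : Module.Dual ℂ (homogeneousSubmodule (Fin N) ℂ m) :=
    ((basisMonomials (Fin N) ℂ).constr ℂ fun s =>
      if h : ∃ α : Fin m → Fin N, wordExponent α = s
      then coeff (shiftExponent h.choose) p else 0) ∘ₗ
    (homogeneousSubmodule (Fin N) ℂ m).subtype
  have hφ : ∀ α : Fin m → Fin N,
      φ ⟨wordMonomial α, wordMonomial_mem α⟩ = coeff (shiftExponent α) p := by
    intro α
    have hex : ∃ β : Fin m → Fin N, wordExponent β = wordExponent α := ⟨α, rfl⟩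
    have h1 : φ ⟨wordMonomial α, wordMonomial_mem α⟩ = coeff (shiftExponent hex.choose) p := by
      simp only [φ, LinearMap.comp_apply, Submodule.subtype_apply]
      rw [wordMonomial_eq]
      exact ((basisMonomials (Fin N) ℂ).constr_basis ℂ _ (wordExponent α)).trans (dif_pos hex)
    obtain ⟨σ, hσ⟩ := exists_perm_of_wordExponent_eq hex.choose_spec
    rw [h1, ← hσ, coeff_shiftExponent_comp hp]
  refine ⟨φ, ?_⟩
  ext s
  by_cases hs : ∃ α : Fin m → Fin N, shiftExponent α = s
  · obtain ⟨α, rfl⟩ := hs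
    rw [coeff_Pfun, hφ]
  · have h0 : coeff s (Pfun N m φ) = 0 := by
      by_contra hne
      exact hs (exists_shiftExponent_eq_of_coeff_Pfun_ne_zero φ hne)
    rw [h0]
    by_contra hne
    have hmem : s ∈ p.support := mem_support_iff.mpr (Ne.symm hne)
    have hpos : ∀ j, s j ≠ 0 := by
      intro j hj
      obtain ⟨f, rfl⟩ := hdvd
      rw [← Finset.mul_prod_erase _ _ (Finset.mem_univ j), mul_assoc, coeff_X_mul'] at hne
      simp [hj] at hne
    have hle : ∀ j, s j ≤ N := fun j => (monomial_le_degreeOf j hmem).trans (hdeg j)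
    refine hs ⟨fun j => ⟨s j - 1, ?_⟩, ?_⟩
    · have := hpos j
      have := hle j
      omega
    · ext j
      have := hpos j
      simp only [shiftExponent, Finsupp.equivFunOnFinite_symm_apply_apply]
      omega

lemma range_Pfun : Set.range (Pfun N m) =
    {p : MvPolynomial (Fin m) ℂ | p.IsSymmetric ∧
      (∃ f, p = (∏ j : Fin m, X j) * f) ∧ ∀ j : Fin m, p.degreeOf j ≤ N} := by
  ext p
  constructor
  · rintro ⟨φ, rfl⟩
    refine ⟨Pfun_isSymmetric φ, ⟨_, Pfun_eq_prod_mul_Pquot φ⟩, fun j => ?_⟩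
    rw [degreeOf_le_iff]
    intro s hs
    obtain ⟨α, rfl⟩ := exists_shiftExponent_eq_of_coeff_Pfun_ne_zero φ (mem_support_iff.mp hs)
    exact (α j).2
  · rintro ⟨hp, hdvd, hdeg⟩
    exact exists_Pfun_eq hp hdvd hdeg

/-- The functional on all polynomials that is `φ` on the component of degree `m` and zero on the
other homogeneous components. -/
def extendDual : MvPolynomial (Fin N) ℂ →ₗ[ℂ] ℂ :=
  φ ∘ₗ (homogeneousComponent m).codRestrict (homogeneousSubmodule (Fin N) ℂ m)
    (homogeneousComponent_mem m)

lemma extendDual_of_mem {p : MvPolynomial (Fin N) ℂ} (hp : p ∈ homogeneousSubmodule (Fin N) ℂ m) :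
    extendDual φ p = φ ⟨p, hp⟩ := by
  rw [extendDual, LinearMap.comp_apply]
  congr 1
  apply Subtype.ext
  rw [LinearMap.codRestrict_apply, homogeneousComponent_of_mem hp, if_pos rfl]

lemma extendDual_of_mem_of_ne {q : ℕ} {p : MvPolynomial (Fin N) ℂ}
    (hp : p ∈ homogeneousSubmodule (Fin N) ℂ q) (hq : m ≠ q) : extendDual φ p = 0 := by
  rw [extendDual, LinearMap.comp_apply]
  convert map_zero φ
  apply Subtype.ext
  rw [LinearMap.codRestrict_apply, homogeneousComponent_of_mem hp, if_neg hq]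
  rfl

/-- The coefficient of `t ^ (n + d)` in `e(t) ^ d`. -/
def currentCoeff (N d n : ℕ) : MvPolynomial (Fin N) ℂ :=
  ∑ α : Fin d → Fin N with ∑ j, (α j).1 = n, wordMonomial α

lemma currentCoeff_mem (N d n : ℕ) : currentCoeff N d n ∈ homogeneousSubmodule (Fin N) ℂ d :=
  Submodule.sum_mem _ fun α _ => wordMonomial_mem α

lemma currentCoeff_zero (d : ℕ) (h : 0 < N) : currentCoeff N d 0 = X ⟨0, h⟩ ^ d := by
  rw [currentCoeff, Finset.sum_eq_single fun _ => ⟨0, h⟩]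
  · simp [wordMonomial]
  · intro α hα hne
    refine absurd (funext fun j => Fin.ext ?_) hne
    simpa using (Finset.sum_eq_zero_iff.mp (Finset.mem_filter.mp hα).2) j (Finset.mem_univ j)
  · simp

lemma currentCoeff_top (d : ℕ) (h : 0 < N) :
    currentCoeff N d (d * (N - 1)) = X ⟨N - 1, Nat.sub_lt h Nat.one_pos⟩ ^ d := by
  rw [currentCoeff, Finset.sum_eq_single fun _ => ⟨N - 1, Nat.sub_lt h Nat.one_pos⟩]
  · simp [wordMonomial]
  · intro α hα hne
    refine absurd (funext fun j => Fin.ext ?_) hne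
    have hle : ∀ j ∈ Finset.univ, (α j).1 ≤ N - 1 := fun j _ => Nat.le_sub_one_of_lt (α j).2
    refine (Finset.sum_eq_sum_iff_of_le hle).mp ?_ j (Finset.mem_univ j)
    rw [(Finset.mem_filter.mp hα).2]
    simp
  · simp

lemma genSet_eq (k l r : ℕ) (hN : 0 < N) : genSet N k l r =
    {currentCoeff N (l + 1) 0} ∪ {currentCoeff N (r + 1) ((r + 1) * (N - 1))} ∪
      {p | ∃ n ≤ (k + 1) * (N - 1), p = currentCoeff N (k + 1) n} := by
  rw [currentCoeff_zero _ hN, currentCoeff_top _ hN, genSet]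
  have hmul : N * (k + 1) = (k + 1) * (N - 1) + (k + 1) := by
    obtain ⟨M, rfl⟩ : ∃ M, N = M + 1 := ⟨N - 1, by omega⟩
    simp only [Nat.add_sub_cancel]
    ring
  have hcurrent : ∀ n, currentCoeff N (k + 1) n = ∑ α ∈ Finset.univ.filter
      (fun α : Fin (k + 1) → Fin N => (∑ j, ((α j).1 + 1)) = n + (k + 1)), ∏ j, X (α j) := by
    intro n
    simp only [currentCoeff, Finset.sum_add_distrib, wordMonomial]
    simp
  congr 1
  · simp [hN]
  · ext p
    constructor
    · rintro ⟨i, hi, hi', rfl⟩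
      refine ⟨i - (k + 1), by omega, ?_⟩
      rw [hcurrent, Nat.sub_add_cancel hi]
    · rintro ⟨n, hn, rfl⟩
      exact ⟨n + (k + 1), by omega, by omega, hcurrent n⟩

/-- `φ` kills the degree `m` part of the ideal generated by `g`. -/
def Kills (g : MvPolynomial (Fin N) ℂ) : Prop := ∀ p, extendDual φ (p * g) = 0

lemma annihilates_iff (k l r : ℕ) :
    (∀ (p : MvPolynomial (Fin N) ℂ) (_ : p ∈ IdealN N k l r)
      (hp' : p ∈ homogeneousSubmodule (Fin N) ℂ m), φ ⟨p, hp'⟩ = 0) ↔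
    ∀ g ∈ genSet N k l r, Kills φ g := by
  constructor
  · intro h g hg p
    obtain ⟨d, hd⟩ : ∃ d, g ∈ homogeneousSubmodule (Fin N) ℂ d := by
      rcases Nat.eq_zero_or_pos N with h0 | h0
      · subst h0
        refine ⟨0, ?_⟩
        rw [mem_homogeneousSubmodule, eq_C_of_isEmpty g]
        exact isHomogeneous_C _ _
      · rw [genSet_eq _ _ _ h0] at hg
        rcases hg with (rfl | rfl) | ⟨n, -, rfl⟩
        exacts [⟨_, currentCoeff_mem _ _ _⟩, ⟨_, currentCoeff_mem _ _ _⟩,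
          ⟨_, currentCoeff_mem _ _ _⟩]
    induction p using MvPolynomial.induction_on' with
    | add p q hp hq => rw [add_mul, map_add, hp, hq, add_zero]
    | monomial s a =>
      have hmem : monomial s a * g ∈ homogeneousSubmodule (Fin N) ℂ (s.degree + d) :=
        (isHomogeneous_monomial a rfl).mul hd
      by_cases hm : m = s.degree + d
      · subst hm
        rw [extendDual_of_mem φ hmem]
        exact h _ (Ideal.mul_mem_left _ _ (Ideal.subset_span hg)) hmem
      · exact extendDual_of_mem_of_ne φ hmem hm
  · intro h p hp hp'
    rw [← extendDual_of_mem φ hp']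
    have hkills : Kills φ p := by
      clear hp'
      induction hp using Submodule.span_induction with
      | mem g hg => exact h g hg
      | zero => exact fun q => by rw [mul_zero, map_zero]
      | add x y hx hy ihx ihy => exact fun q => by rw [mul_add, map_add, ihx, ihy, add_zero]
      | smul a x hx ih => exact fun q => by rw [smul_eq_mul, ← mul_assoc, ih]
    simpa using hkills 1

lemma kills_of_lt {d n : ℕ} (hd : m < d) : Kills φ (currentCoeff N d n) := by
  intro p
  induction p using MvPolynomial.induction_on' with
  | add p q hp hq => rw [add_mul, map_add, hp, hq, add_zero]
  | monomial s a =>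
    exact extendDual_of_mem_of_ne φ (q := s.degree + d)
      ((isHomogeneous_monomial a rfl).mul (currentCoeff_mem N d n)) (by omega)

lemma kills_iff {d q n : ℕ} (φ : Module.Dual ℂ (homogeneousSubmodule (Fin N) ℂ (d + q))) :
    Kills φ (currentCoeff N d n) ↔
      ∀ b : Fin q → Fin N, extendDual φ (wordMonomial b * currentCoeff N d n) = 0 := by
  refine ⟨fun h b => h _, fun h p => ?_⟩
  induction p using MvPolynomial.induction_on' with
  | add p q hp hq => rw [add_mul, map_add, hp, hq, add_zero]
  | monomial s a =>
    by_cases hs : s.degree = q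
    · obtain ⟨b, rfl⟩ := exists_wordExponent_eq q s hs
      have hsmul : monomial (wordExponent b) a = a • wordMonomial b := by
        rw [wordMonomial_eq, smul_monomial, smul_eq_mul, mul_one]
      rw [hsmul, smul_mul_assoc, map_smul, h b, smul_zero]
    · exact extendDual_of_mem_of_ne φ (q := s.degree + d)
        ((isHomogeneous_monomial a rfl).mul (currentCoeff_mem N d n)) (by omega)

lemma aeval_append_Pquot {d q : ℕ} (φ : Module.Dual ℂ (homogeneousSubmodule (Fin N) ℂ (d + q)))
    (T : MvPolynomial (Fin (d + q)) ℂ) :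
    aeval (Fin.append (fun _ : Fin d => T) fun j : Fin q => X (Fin.natAdd d j)) (Pquot φ) =
      ∑ b : Fin q → Fin N, ∑ n ∈ Finset.range (d * (N - 1) + 1),
        C (extendDual φ (wordMonomial b * currentCoeff N d n)) *
          (T ^ n * ∏ j, X (Fin.natAdd d j) ^ (b j).1) := by
  rw [Pquot, map_sum, ← (Fin.appendEquiv d q).sum_comp, Fintype.sum_prod_type_right]
  refine Finset.sum_congr rfl fun b _ => ?_
  have hmaps : ∀ a ∈ (Finset.univ : Finset (Fin d → Fin N)),
      ∑ j, (a j).1 ∈ Finset.range (d * (N - 1) + 1) := by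
    intro a _
    have := Finset.sum_le_card_nsmul Finset.univ (fun j => (a j).1) (N - 1)
      fun j _ => Nat.le_sub_one_of_lt (a j).2
    rw [Finset.mem_range]
    simp at this
    omega
  rw [← Finset.sum_fiberwise_of_maps_to hmaps]
  refine Finset.sum_congr rfl fun n _ => ?_
  rw [currentCoeff, Finset.mul_sum, map_sum, map_sum, Finset.sum_mul]
  refine Finset.sum_congr rfl fun a ha => ?_
  have happ : wordMonomial b * wordMonomial a = wordMonomial (Fin.append a b) := by
    simp only [wordMonomial, Fin.prod_univ_add, Fin.append_left, Fin.append_right]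
    exact mul_comm _ _
  rw [← (Finset.mem_filter.mp ha).2, happ, extendDual_of_mem φ (wordMonomial_mem _)]
  rw [show Fin.appendEquiv d q (a, b) = Fin.append a b from rfl]
  simp [Fin.prod_univ_add, Finset.prod_pow_eq_pow_sum, algebraMap_eq]

/-- The exponent vector of `t_0 ^ n * ∏ j, t_{d + 1 + j} ^ b_j`. -/
def blockExponent (d : ℕ) {q : ℕ} (n : ℕ) (b : Fin q → Fin N) : Fin (d + 1 + q) →₀ ℕ :=
  Finsupp.equivFunOnFinite.symm
    (Fin.append (Fin.cons n 0 : Fin (d + 1) → ℕ) fun j => (b j).1)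

lemma blockExponent_zero (d : ℕ) {q : ℕ} (n : ℕ) (b : Fin q → Fin N) (h : 0 < d + 1 + q) :
    blockExponent d n b ⟨0, h⟩ = n := by
  rw [blockExponent, Finsupp.equivFunOnFinite_symm_apply_apply]
  exact Fin.append_left (Fin.cons n 0 : Fin (d + 1) → ℕ) _ 0

lemma blockExponent_inj {d q n n' : ℕ} {b b' : Fin q → Fin N} :
    blockExponent d n b = blockExponent d n' b' ↔ n = n' ∧ b = b' := by
  refine ⟨fun h => ⟨?_, funext fun j => Fin.ext ?_⟩, by rintro ⟨rfl, rfl⟩; rfl⟩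
  · rw [← blockExponent_zero d n b (by omega), h, blockExponent_zero]
  · simpa [blockExponent] using DFunLike.congr_fun h (Fin.natAdd (d + 1) j)

lemma X_pow_mul_prod_eq_monomial (d : ℕ) {q : ℕ} (n : ℕ) (b : Fin q → Fin N)
    (h : 0 < d + 1 + q) :
    (X ⟨0, h⟩ ^ n * ∏ j, X (Fin.natAdd (d + 1) j) ^ (b j).1 :
      MvPolynomial (Fin (d + 1 + q)) ℂ) = monomial (blockExponent d n b) 1 := by
  rw [blockExponent, ← prod_X_pow_eq_monomial_equivFunOnFinite, Fin.prod_univ_add,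
    Fin.prod_univ_succ]
  simp only [Fin.append_left, Fin.append_right, Fin.cons_zero, Fin.cons_succ, Pi.zero_apply,
    pow_zero, Finset.prod_const_one, mul_one]
  rfl

lemma eval_aeval_eq {σ τ : Type*} (x : τ → ℂ) (g : σ → MvPolynomial τ ℂ) (f : MvPolynomial σ ℂ) :
    eval x (aeval g f) = eval (fun i => eval x (g i)) f := by
  rw [← coe_aeval_eq_eval, ← coe_aeval_eq_eval]
  exact comp_aeval_apply g (aeval x) f

section Substitution

variable {d q : ℕ} (φ : Module.Dual ℂ (homogeneousSubmodule (Fin N) ℂ (d + 1 + q)))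

/-- The quotient `P(φ) / (t_1 ⋯ t_m)` with its first `d + 1` variables set equal. -/
def diagonal : MvPolynomial (Fin (d + 1 + q)) ℂ :=
  aeval (Fin.append (fun _ : Fin (d + 1) => X ⟨0, by omega⟩)
    fun j : Fin q => X (Fin.natAdd (d + 1) j)) (Pquot φ)

lemma diagonal_eq : diagonal φ =
    ∑ b : Fin q → Fin N, ∑ n ∈ Finset.range ((d + 1) * (N - 1) + 1),
      monomial (blockExponent d n b)
        (extendDual φ (wordMonomial b * currentCoeff N (d + 1) n)) := by
  rw [diagonal, aeval_append_Pquot]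
  simp only [X_pow_mul_prod_eq_monomial, C_mul_monomial, mul_one]

lemma coeff_diagonal {n : ℕ} (hn : n ≤ (d + 1) * (N - 1)) (b : Fin q → Fin N) :
    coeff (blockExponent d n b) (diagonal φ) =
      extendDual φ (wordMonomial b * currentCoeff N (d + 1) n) := by
  classical
  rw [diagonal_eq, coeff_sum, Finset.sum_eq_single b, coeff_sum, Finset.sum_eq_single n]
  · rw [coeff_monomial, if_pos rfl]
  · intro n' _ hne
    rw [coeff_monomial, if_neg fun h => hne (blockExponent_inj.mp h).1]
  · intro h
    exact absurd (Finset.mem_range.mpr (by omega)) h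
  · intro b' _ hne
    rw [coeff_sum]
    exact Finset.sum_eq_zero fun n' _ => by
      rw [coeff_monomial, if_neg fun h => hne (blockExponent_inj.mp h).2]
  · simp

lemma exists_blockExponent_eq_of_coeff_diagonal_ne_zero {s : Fin (d + 1 + q) →₀ ℕ}
    (hs : coeff s (diagonal φ) ≠ 0) :
    ∃ n ≤ (d + 1) * (N - 1), ∃ b : Fin q → Fin N, blockExponent d n b = s := by
  classical
  by_contra! h
  refine hs ?_
  rw [diagonal_eq, coeff_sum]
  refine Finset.sum_eq_zero fun b _ => ?_
  rw [coeff_sum]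
  refine Finset.sum_eq_zero fun n hn => ?_
  rw [coeff_monomial, if_neg (h n (Nat.lt_succ_iff.mp (Finset.mem_range.mp hn)) b)]

lemma diagonal_eq_zero_iff :
    diagonal φ = 0 ↔ ∀ n ≤ (d + 1) * (N - 1), Kills φ (currentCoeff N (d + 1) n) := by
  simp only [kills_iff]
  constructor
  · intro h n hn b
    rw [← coeff_diagonal φ hn, h, coeff_zero]
  · intro h
    ext s
    by_contra hne
    obtain ⟨n, hn, b, rfl⟩ := exists_blockExponent_eq_of_coeff_diagonal_ne_zero φ hne
    exact hne (by rw [coeff_diagonal φ hn, h n hn, coeff_zero])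

lemma degreeOf_diagonal_lt_iff (hN : 2 ≤ N) :
    degreeOf ⟨0, by omega⟩ (diagonal φ) < (d + 1) * (N - 1) ↔
      Kills φ (currentCoeff N (d + 1) ((d + 1) * (N - 1))) := by
  rw [degreeOf_lt_iff (Nat.mul_pos d.succ_pos (by omega)), kills_iff]
  constructor
  · intro h b
    by_contra hne
    rw [← coeff_diagonal φ le_rfl] at hne
    have := h _ (mem_support_iff.mpr hne)
    rw [blockExponent_zero] at this
    exact lt_irrefl _ this
  · intro h s hs
    rw [mem_support_iff] at hs
    obtain ⟨n, hn, b, rfl⟩ := exists_blockExponent_eq_of_coeff_diagonal_ne_zero φ hs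
    rw [blockExponent_zero]
    refine lt_of_le_of_ne hn ?_
    rintro rfl
    exact hs (by rw [coeff_diagonal φ hn, h])

lemma aeval_append_zero_Pquot_eq_zero_iff :
    aeval (Fin.append (fun _ : Fin (d + 1) => (0 : MvPolynomial (Fin (d + 1 + q)) ℂ))
      fun j : Fin q => X (Fin.natAdd (d + 1) j)) (Pquot φ) = 0 ↔
      Kills φ (currentCoeff N (d + 1) 0) := by
  classical
  have hsum : aeval (Fin.append (fun _ : Fin (d + 1) => (0 : MvPolynomial (Fin (d + 1 + q)) ℂ))
      fun j : Fin q => X (Fin.natAdd (d + 1) j)) (Pquot φ) = ∑ b : Fin q → Fin N,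
      monomial (blockExponent d 0 b)
        (extendDual φ (wordMonomial b * currentCoeff N (d + 1) 0)) := by
    rw [aeval_append_Pquot]
    refine Finset.sum_congr rfl fun b _ => ?_
    rw [Finset.sum_eq_single 0]
    · rw [pow_zero, ← pow_zero (X ⟨0, by omega⟩), X_pow_mul_prod_eq_monomial, C_mul_monomial,
        mul_one]
    · intro n _ hn
      rw [zero_pow hn, zero_mul, mul_zero]
    · simp
  rw [hsum, kills_iff]
  constructor
  · intro h b
    have hb := congrArg (coeff (blockExponent d 0 b)) h
    rw [coeff_sum, Finset.sum_eq_single b, coeff_monomial, if_pos rfl, coeff_zero] at hb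
    · exact hb
    · intro b' _ hne
      rw [coeff_monomial, if_neg fun h => hne (blockExponent_inj.mp h).2]
    · simp
  · intro h
    exact Finset.sum_eq_zero fun b _ => by rw [h, monomial_zero]

end Substitution

lemma eval_eq_zero_of_eq_iff {d : ℕ} (hd : d + 1 ≤ m) :
    (∀ x : Fin m → ℂ, (∀ j j' : Fin m, j.1 ≤ d → j'.1 ≤ d → x j = x j') →
      eval x (Pquot φ) = 0) ↔
      ∀ n ≤ (d + 1) * (N - 1), Kills φ (currentCoeff N (d + 1) n) := by
  obtain ⟨q, rfl⟩ := Nat.exists_eq_add_of_le hd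
  rw [← diagonal_eq_zero_iff]
  constructor
  · intro h
    refine MvPolynomial.funext fun x => ?_
    rw [diagonal, eval_aeval_eq, map_zero]
    refine h _ fun j j' hj hj' => ?_
    have hval : ∀ j : Fin (d + 1 + q), j.1 ≤ d → eval x (Fin.append
        (fun _ : Fin (d + 1) => (X ⟨0, by omega⟩ : MvPolynomial (Fin (d + 1 + q)) ℂ))
        (fun j : Fin q => X (Fin.natAdd (d + 1) j)) j) = x ⟨0, by omega⟩ := by
      intro j hj
      induction j using Fin.addCases with
      | left i => rw [Fin.append_left, eval_X]
      | right i =>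
        rw [Fin.val_natAdd] at hj
        omega
    rw [hval j hj, hval j' hj']
  · intro h x hx
    have h0 := congrArg (eval x) h
    rw [diagonal, eval_aeval_eq, map_zero] at h0
    convert h0 using 2
    congr 1
    funext j
    induction j using Fin.addCases with
    | left i =>
      rw [Fin.append_left, eval_X]
      exact hx _ _ (by rw [Fin.val_castAdd]; omega) (Nat.zero_le _)
    | right i => rw [Fin.append_right, eval_X]

lemma eval_eq_zero_of_eq_zero_iff {d : ℕ} (hd : d + 1 ≤ m) :
    (∀ x : Fin m → ℂ, (∀ j : Fin m, j.1 ≤ d → x j = 0) → eval x (Pquot φ) = 0) ↔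
      Kills φ (currentCoeff N (d + 1) 0) := by
  obtain ⟨q, rfl⟩ := Nat.exists_eq_add_of_le hd
  rw [← aeval_append_zero_Pquot_eq_zero_iff]
  constructor
  · intro h
    refine MvPolynomial.funext fun x => ?_
    rw [eval_aeval_eq, map_zero]
    refine h _ fun j hj => ?_
    induction j using Fin.addCases with
    | left i => rw [Fin.append_left, map_zero]
    | right i =>
      rw [Fin.val_natAdd] at hj
      omega
  · intro h x hx
    have h0 := congrArg (eval x) h
    rw [eval_aeval_eq, map_zero] at h0
    convert h0 using 2
    congr 1
    funext j
    induction j using Fin.addCases with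
    | left i =>
      rw [Fin.append_left, map_zero]
      exact hx _ (by rw [Fin.val_castAdd]; omega)
    | right i => rw [Fin.append_right, eval_X]

lemma degreeOf_lt_iff_kills {d : ℕ} (hN : 2 ≤ N) (hd : d + 1 ≤ m) :
    degreeOf (⟨0, by omega⟩ : Fin m)
        (aeval (fun j : Fin m =>
            if j.1 ≤ d then (X ⟨0, by omega⟩ : MvPolynomial (Fin m) ℂ) else X j) (Pquot φ)) <
      (d + 1) * (N - 1) ↔ Kills φ (currentCoeff N (d + 1) ((d + 1) * (N - 1))) := by
  obtain ⟨q, rfl⟩ := Nat.exists_eq_add_of_le hd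
  rw [← degreeOf_diagonal_lt_iff φ hN, diagonal]
  have hfun : (fun j : Fin (d + 1 + q) =>
      if j.1 ≤ d then (X ⟨0, by omega⟩ : MvPolynomial (Fin (d + 1 + q)) ℂ) else X j) =
      Fin.append (fun _ : Fin (d + 1) => X ⟨0, by omega⟩)
        fun j : Fin q => X (Fin.natAdd (d + 1) j) := by
    funext j
    induction j using Fin.addCases with
    | left i => rw [Fin.append_left, if_pos (by rw [Fin.val_castAdd]; omega)]
    | right i => rw [Fin.append_right, if_neg (by rw [Fin.val_natAdd]; omega)]
  rw [hfun]

lemma Fconds_Pquot_iff (k l r : ℕ) (hN : 2 ≤ N) :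
    Fconds N k l r m (Pquot φ) ↔ ∀ g ∈ genSet N k l r, Kills φ g := by
  have imp_iff : ∀ {d : ℕ} {P Q : Prop}, (d + 1 ≤ m → (P ↔ Q)) → (m < d + 1 → Q) →
      ((d + 1 ≤ m → P) ↔ Q) := by
    intro d P Q h h'
    refine ⟨fun hP => ?_, fun hQ hd => (h hd).mpr hQ⟩
    rcases le_or_gt (d + 1) m with hd | hd
    exacts [(h hd).mp (hP hd), h' hd]
  have h1 := imp_iff (fun hd : k + 1 ≤ m => eval_eq_zero_of_eq_iff φ hd)
    fun hd n _ => kills_of_lt φ hd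
  have h2 := imp_iff (fun hd : l + 1 ≤ m => eval_eq_zero_of_eq_zero_iff φ hd)
    fun hd => kills_of_lt φ hd
  have h3 : (∀ hd : r + 1 ≤ m, degreeOf (⟨0, by omega⟩ : Fin m)
        (aeval (fun j : Fin m =>
            if j.1 ≤ r then (X ⟨0, by omega⟩ : MvPolynomial (Fin m) ℂ) else X j) (Pquot φ)) <
      (r + 1) * (N - 1)) ↔ Kills φ (currentCoeff N (r + 1) ((r + 1) * (N - 1))) := by
    refine ⟨fun h => ?_, fun h hd => (degreeOf_lt_iff_kills φ hN hd).mpr h⟩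
    rcases le_or_gt (r + 1) m with hd | hd
    exacts [(degreeOf_lt_iff_kills φ hN hd).mp (h hd), kills_of_lt φ hd]
  rw [Fconds, h1, h2, h3, genSet_eq k l r (by omega)]
  constructor
  · rintro ⟨hk, hl, hr⟩ g ((rfl | rfl) | ⟨n, hn, rfl⟩)
    exacts [hl, hr, hk n hn]
  · intro h
    exact ⟨fun n hn => h _ (Or.inr ⟨n, hn, rfl⟩), h _ (Or.inl (Or.inl rfl)),
      h _ (Or.inl (Or.inr rfl))⟩

end Realization

theorem functional_realization (N k l r m : ℕ) (hN : 2 ≤ N) (hk : 1 ≤ k) :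
    IsLinearMap ℂ (Pfun N m) ∧
    Function.Injective (Pfun N m) ∧
    Set.range (Pfun N m) =
      {p : MvPolynomial (Fin m) ℂ | p.IsSymmetric ∧
        (∃ f, p = (∏ j : Fin m, X j) * f) ∧ ∀ j : Fin m, p.degreeOf j ≤ N} ∧
    (∀ φ : Module.Dual ℂ (homogeneousSubmodule (Fin N) ℂ m),
      (∀ (p : MvPolynomial (Fin N) ℂ) (_ : p ∈ IdealN N k l r)
          (hp' : p ∈ homogeneousSubmodule (Fin N) ℂ m), φ ⟨p, hp'⟩ = 0) ↔
      ∃ f : MvPolynomial (Fin m) ℂ,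
        Pfun N m φ = (∏ j : Fin m, X j) * f ∧ Fconds N k l r m f) ∧
    Pfun N m '' {φ | ∀ (p : MvPolynomial (Fin N) ℂ) (_ : p ∈ IdealN N k l r)
          (hp' : p ∈ homogeneousSubmodule (Fin N) ℂ m), φ ⟨p, hp'⟩ = 0} =
      {p : MvPolynomial (Fin m) ℂ | p.IsSymmetric ∧ (∀ j : Fin m, p.degreeOf j ≤ N) ∧
        ∃ f, p = (∏ j : Fin m, X j) * f ∧ Fconds N k l r m f} := by
  have hann : ∀ φ : Module.Dual ℂ (homogeneousSubmodule (Fin N) ℂ m),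
      (∀ (p : MvPolynomial (Fin N) ℂ) (_ : p ∈ IdealN N k l r)
          (hp' : p ∈ homogeneousSubmodule (Fin N) ℂ m), φ ⟨p, hp'⟩ = 0) ↔
      ∃ f : MvPolynomial (Fin m) ℂ,
        Pfun N m φ = (∏ j : Fin m, X j) * f ∧ Fconds N k l r m f := by
    intro φ
    rw [annihilates_iff, ← Fconds_Pquot_iff φ k l r hN]
    constructor
    · exact fun h => ⟨_, Pfun_eq_prod_mul_Pquot φ, h⟩
    · rintro ⟨f, hf, hcond⟩
      rwa [← eq_Pquot_of_Pfun_eq φ hf]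
  refine ⟨isLinearMap_Pfun, Pfun_injective, range_Pfun, hann, ?_⟩
  ext p
  constructor
  · rintro ⟨φ, hφ, rfl⟩
    have hrange := range_Pfun.subset (Set.mem_range_self φ)
    exact ⟨hrange.1, hrange.2.2, (hann φ).mp hφ⟩
  · rintro ⟨hp, hdeg, f, hf, hcond⟩
    obtain ⟨φ, rfl⟩ := exists_Pfun_eq hp ⟨f, hf⟩ hdeg
    exact ⟨φ, (hann φ).mpr ⟨f, hf, hcond⟩, rfl⟩

end
end
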